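/- arXiv:1303.7313 — 3 statements merged into one kernel-verified Lean document; each statement's English description precedes it below -/
import Mathlib

section
/- Let a ∈ (0,1), c ∈ ℝ, and α ∈ [0, 3/8). Then lim_{n→∞} n^{3/4} · Q_n(⌊an − c·n^α⌋, ⌊(1−a)n − c·n^α⌋) / C_n = Γ(3/4) / (2^{3/2} · π · (a(1−a))^{3/4}), where Γ is the Gamma function. -/
open Filter Finset Real

/-- `σ` contains the pattern `τ`. -/
def ContainsPattern {n m : ℕ} (σ : Equiv.Perm (Fin n)) (τ : Equiv.Perm (Fin m)) : Prop :=
  ∃ f : Fin m → Fin n, StrictMono f ∧ ∀ a b : Fin m, σ (f a) < σ (f b) ↔ τ a < τ b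

/-- `σ` avoids the pattern `τ`. -/
def Avoids {n m : ℕ} (σ : Equiv.Perm (Fin n)) (τ : Equiv.Perm (Fin m)) : Prop :=
  ¬ ContainsPattern σ τ

/-- The pattern (1,2,3) ∈ S₃ (0-indexed: 0,1,2). -/
def pattern123 : Equiv.Perm (Fin 3) := 1

/-- The pattern (1,3,2) ∈ S₃ (0-indexed: 0,2,1). -/
def pattern132 : Equiv.Perm (Fin 3) := Equiv.swap 1 2

/-- The pattern (3,2,1) ∈ S₃ (0-indexed: 2,1,0). -/
def pattern321 : Equiv.Perm (Fin 3) := Equiv.swap 0 2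

/-- The pattern (2,3,1) ∈ S₃ (0-indexed: 1,2,0). -/
def pattern231 : Equiv.Perm (Fin 3) := (Equiv.swap 1 2).trans (Equiv.swap 0 1)

/-- `Q_n(j,k)` with integer arguments: the number of 132-avoiding permutations of
`{1,…,n}` with value `k` in position `j` (1-indexed); `0` when `j` or `k` is out of
range. -/
noncomputable def QcountZ (n : ℕ) (j k : ℤ) : ℕ :=
  Nat.card {σ : Equiv.Perm (Fin n) //
    Avoids σ pattern132 ∧ ∃ i : Fin n, ((i : ℕ) : ℤ) + 1 = j ∧ ((σ i : ℕ) : ℤ) + 1 = k}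

/-- A list of naturals avoids 132. -/
def LAv (l : List ℕ) : Prop :=
  ∀ x y z : ℕ, List.Sublist [x, y, z] l → ¬ (x < z ∧ z < y)

/-- The list attached to a tree, with values starting at `b`. -/
def tlist : ℕ → BinaryTree Unit → List ℕ
  | _, .nil => []
  | b, .node _ l r => tlist (b + r.numNodes) l ++ (b + r.numNodes + l.numNodes) :: tlist b r

lemma tlist_length (t : BinaryTree Unit) : ∀ b, (tlist b t).length = t.numNodes := by
  induction t with
  | nil => intro b; simp [tlist]
  | node _ l r ihl ihr => intro b; simp [tlist, ihl, ihr, BinaryTree.numNodes]; ring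

lemma tlist_map (t : BinaryTree Unit) : ∀ b, tlist b t = (tlist 0 t).map (· + b) := by
  induction t with
  | nil => intro b; simp [tlist]
  | node _ l r ihl ihr =>
    intro b
    simp only [tlist, List.map_append, List.map_cons]
    rw [ihl (b + r.numNodes), ihl (0 + r.numNodes), ihr b]
    simp only [List.map_map]
    congr 1
    · apply List.map_congr_left; intro x _; simp; ring
    · congr 1; ring

lemma range'_split (b p q : ℕ) : List.range' b (p + q) = List.range' b p ++ List.range' (b + p) q := by
  rw [List.range'_append_1]

lemma tlist_perm (t : BinaryTree Unit) : ∀ b, (tlist b t).Perm (List.range' b t.numNodes) := by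
  induction t with
  | nil => intro b; simp [tlist]
  | node _ l r ihl ihr =>
    intro b
    simp only [tlist, BinaryTree.numNodes]
    have h : List.range' b (l.numNodes + r.numNodes + 1) =
        (List.range' b r.numNodes ++ List.range' (b + r.numNodes) l.numNodes) ++
          [b + r.numNodes + l.numNodes] := by
      rw [List.range'_append_1, show l.numNodes + r.numNodes + 1 = (r.numNodes + l.numNodes) + 1 by ring,
        ← List.range'_append_1]
      simp [add_assoc]
    rw [h]
    refine List.perm_middle.trans ?_
    refine List.Perm.trans ?_ (List.perm_append_singleton _ _).symm
    refine List.Perm.cons _ ?_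
    exact List.perm_append_comm.trans ((ihr b).append (ihl _))

lemma tlist_mem {t : BinaryTree Unit} {b x : ℕ} : x ∈ tlist b t ↔ b ≤ x ∧ x < b + t.numNodes := by
  rw [(tlist_perm t b).mem_iff]; simp [List.mem_range'_1]

lemma tlist_inj (t : BinaryTree Unit) : ∀ b t', tlist b t = tlist b t' → t = t' := by
  induction t with
  | nil =>
    intro b t' h
    cases t' with
    | nil => rfl
    | node _ l r => simp [tlist] at h
  | node u l r ihl ihr =>
    intro b t' h
    cases t' with
    | nil => simp [tlist] at h
    | node u' l' r' =>
      have hlen := congrArg List.length h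
      rw [tlist_length, tlist_length] at hlen
      simp only [BinaryTree.numNodes] at hlen
      simp only [tlist] at h
      have e : b + r'.numNodes + l'.numNodes = b + r.numNodes + l.numNodes := by omega
      rw [e] at h
      have := List.append_cons_inj_of_notMem (x₁ := tlist (b + r.numNodes) l) (x₂ := tlist (b + r'.numNodes) l') (z₁ := tlist b r) (z₂ := tlist b r') (a₁ := b + r.numNodes + l.numNodes) (a₂ := b + r.numNodes + l.numNodes) ?_ ?_
      · rw [this] at h
        obtain ⟨h1, -, h2⟩ := h
        have hr := ihr _ _ h2
        subst hr
        have hl := ihl _ _ h1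
        subst hl
        rfl
      · rw [tlist_mem]; omega
      · rw [tlist_mem]; omega

lemma LAv_combine {A B : List ℕ} {M : ℕ} (hA : LAv A) (hB : LAv B)
    (hAM : ∀ x ∈ A, x < M) (hBM : ∀ x ∈ B, x < M) (hAB : ∀ x ∈ A, ∀ y ∈ B, y < x) :
    LAv (A ++ M :: B) := by
  intro x y z h hlt
  rw [List.sublist_append_iff] at h
  obtain ⟨s1, s2, he, h1, h2⟩ := h
  match s1, he, h1 with
  | [], he, h1 =>
    simp at he
    subst he
    rw [List.sublist_cons_iff] at h2
    rcases h2 with h2 | ⟨r, hr, h2⟩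
    · exact hB x y z h2 hlt
    · simp at hr
      obtain ⟨rfl, rfl⟩ := hr
      have : z ∈ B := h2.subset (by simp)
      have := hBM z this
      omega
  | [a], he, h1 =>
    simp at he
    obtain ⟨rfl, rfl⟩ := he
    have hx : x ∈ A := h1.subset (by simp)
    have hz : z ∈ B := by
      rw [List.sublist_cons_iff] at h2
      rcases h2 with h2 | ⟨r, hr, h2⟩
      · exact h2.subset (by simp)
      · simp at hr
        obtain ⟨rfl, rfl⟩ := hr
        exact h2.subset (by simp)
    have := hAB x hx z hz
    omega
  | [a, c], he, h1 =>
    simp at he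
    obtain ⟨rfl, rfl, rfl⟩ := he
    have hx : x ∈ A := h1.subset (by simp)
    have hy : y ∈ A := h1.subset (by simp)
    have hz : z ∈ M :: B := h2.subset (by simp)
    rw [List.mem_cons] at hz
    rcases hz with rfl | hz
    · have := hAM y hy; omega
    · have := hAB x hx z hz; omega
  | [a, c, e], he, h1 =>
    simp at he
    obtain ⟨rfl, rfl, rfl, rfl⟩ := he
    exact hA x y z h1 hlt
  | a :: c :: e :: f :: g, he, h1 => simp at he

lemma tlist_LAv (t : BinaryTree Unit) : ∀ b, LAv (tlist b t) := by
  induction t with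
  | nil => intro b x y z h; simp [tlist] at h
  | node _ l r ihl ihr =>
    intro b
    simp only [tlist]
    refine LAv_combine (ihl _) (ihr _) ?_ ?_ ?_
    · intro x hx; rw [tlist_mem] at hx; omega
    · intro x hx; rw [tlist_mem] at hx; omega
    · intro x hx y hy; rw [tlist_mem] at hx hy; omega

lemma split_perm {A B : List ℕ} {b n : ℕ} (hp : (A ++ B).Perm (List.range' b n))
    (hAB : ∀ x ∈ A, ∀ y ∈ B, y < x) :
    B.Perm (List.range' b B.length) ∧ A.Perm (List.range' (b + B.length) A.length) := by
  have hn : A.length + B.length = n := by simpa using hp.length_eq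
  have hs : (B.insertionSort (· ≤ ·) ++ A.insertionSort (· ≤ ·)) =
      List.range' b B.length ++ List.range' (b + B.length) A.length := by
    have e : List.range' b B.length ++ List.range' (b + B.length) A.length = List.range' b n := by
      rw [List.range'_append_1, ← hn, add_comm]
    rw [e]
    refine List.Perm.eq_of_pairwise (le := (· ≤ ·)) ?_ ?_ ?_ ?_
    · intro a b _ _ h1 h2; exact le_antisymm h1 h2
    · rw [List.pairwise_append]
      refine ⟨List.pairwise_insertionSort _ _, List.pairwise_insertionSort _ _, ?_⟩
      intro x hx y hy
      rw [List.mem_insertionSort] at hx hy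
      exact (hAB y hy x hx).le
    · exact List.pairwise_le_range'
    · refine List.Perm.trans ?_ hp
      exact ((List.perm_insertionSort _ _).append (List.perm_insertionSort _ _)).trans
        List.perm_append_comm
  have := List.append_inj hs (by simp)
  constructor
  · rw [← this.1]; exact (List.perm_insertionSort _ _).symm
  · rw [← this.2]; exact (List.perm_insertionSort _ _).symm

lemma tlist_surj (n : ℕ) : ∀ (b : ℕ) (l : List ℕ), l.Perm (List.range' b n) → LAv l →
    ∃ t : BinaryTree Unit, t.numNodes = n ∧ tlist b t = l := by
  induction n using Nat.strong_induction_on with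
  | _ n ih =>
    intro b l hp hl
    cases n with
    | zero =>
      refine ⟨.nil, rfl, ?_⟩
      simp at hp
      simp [tlist, hp]
    | succ n =>
      have hmem : b + n ∈ l := by rw [hp.mem_iff]; simp [List.mem_range'_1]
      obtain ⟨A, B, rfl⟩ := List.append_of_mem hmem
      have hnd : (A ++ (b + n) :: B).Nodup := hp.nodup_iff.2 (List.nodup_range' ..)
      have hp' : (A ++ B).Perm (List.range' b n) := by
        have h1 : ((b + n) :: (A ++ B)).Perm ((b + n) :: List.range' b n) := by
          refine List.perm_middle.symm.trans (hp.trans ?_)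
          rw [← List.range'_append_1]
          simp
        exact (List.perm_cons _).1 h1
      have hlt : ∀ x ∈ A ++ B, x < b + n := by
        intro x hx
        rw [hp'.mem_iff] at hx
        simp [List.mem_range'_1] at hx
        exact hx.2
      have hAB : ∀ x ∈ A, ∀ y ∈ B, y < x := by
        intro x hx y hy
        by_contra hc
        have hne : x ≠ y := by
          rintro rfl
          rw [List.nodup_append] at hnd
          exact hnd.2.2 x hx x (by simp [hy]) rfl
        refine hl x (b + n) y ?_ ⟨by omega, hlt y (by simp [hy])⟩
        have : [x, b + n, y] = [x] ++ (b + n) :: [y] := rfl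
        rw [this]
        exact (List.singleton_sublist.2 hx).append ((List.singleton_sublist.2 hy).cons_cons _)
      have hn : A.length + B.length = n := by simpa using hp'.length_eq
      obtain ⟨hB, hA⟩ := split_perm hp' hAB
      obtain ⟨tl, hl1, hl2⟩ := ih A.length (by omega) _ A hA
        (fun x y z h => hl x y z (h.trans (List.sublist_append_left _ _)))
      obtain ⟨tr, hr1, hr2⟩ := ih B.length (by omega) _ B hB
        (fun x y z h => hl x y z (h.trans ((List.sublist_cons_self _ _).trans
          (List.sublist_append_right _ _))))
      refine ⟨.node () tl tr, ?_, ?_⟩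
      · simp [BinaryTree.numNodes, hl1, hr1, hn]
      · simp only [tlist, hr2, hr1, hl2, hl1]
        congr 2
        omega

/-- The list of values of a permutation. -/
def plist {n : ℕ} (σ : Equiv.Perm (Fin n)) : List ℕ := List.ofFn (fun i => (σ i : ℕ))

lemma plist_perm {n : ℕ} (σ : Equiv.Perm (Fin n)) : (plist σ).Perm (List.range' 0 n) := by
  rw [List.perm_ext_iff_of_nodup]
  · intro a
    simp only [plist, List.mem_ofFn, List.mem_range'_1]
    constructor
    · rintro ⟨i, rfl⟩; omega
    · intro h
      exact ⟨σ.symm ⟨a, by omega⟩, by simp⟩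
  · rw [plist, List.nodup_ofFn]
    intro i j h
    exact σ.injective (Fin.ext h)
  · exact List.nodup_range' ..

lemma plist_inj {n : ℕ} {σ σ' : Equiv.Perm (Fin n)} (h : plist σ = plist σ') : σ = σ' := by
  have := List.ofFn_injective h
  ext i
  exact congrFun this i

lemma plist_surj {n : ℕ} {l : List ℕ} (h : l.Perm (List.range' 0 n)) :
    ∃ σ : Equiv.Perm (Fin n), plist σ = l := by
  have hlen : l.length = n := by simpa using h.length_eq
  have hnd : l.Nodup := h.nodup_iff.2 (List.nodup_range' ..)
  have hlt : ∀ i : Fin n, l[(i : ℕ)]'(by omega) < n := by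
    intro i
    have : l[(i : ℕ)]'(by omega) ∈ l := List.getElem_mem _
    rw [h.mem_iff] at this
    simp [List.mem_range'_1] at this
    exact this
  have hinj : Function.Injective (fun i : Fin n => (⟨l[(i : ℕ)]'(by omega), hlt i⟩ : Fin n)) := by
    intro i j hij
    simp only [Fin.mk.injEq] at hij
    exact Fin.ext ((hnd.getElem_inj_iff).1 hij)
  refine ⟨Equiv.ofBijective _ (Finite.injective_iff_bijective.1 hinj), ?_⟩
  apply List.ext_getElem
  · simp [plist, hlen]
  · intro i h1 h2
    simp [plist]

lemma avoids_iff {n : ℕ} (σ : Equiv.Perm (Fin n)) : Avoids σ pattern132 ↔ LAv (plist σ) := by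
  unfold Avoids
  rw [← not_iff_not, not_not]
  unfold LAv
  push Not
  constructor
  · rintro ⟨f, hf, h⟩
    refine ⟨σ (f 0), σ (f 1), σ (f 2), ?_, ?_, ?_⟩
    · rw [List.sublist_iff_exists_fin_orderEmbedding_get_eq]
      have hl : (plist σ).length = n := by simp [plist]
      refine ⟨OrderEmbedding.ofStrictMono (fun i => Fin.cast hl.symm (f (Fin.cast rfl i))) ?_, ?_⟩
      · intro i j hij
        have : f (Fin.cast rfl i) < f (Fin.cast rfl j) := hf hij
        simpa using this
      · intro i
        match i with
        | ⟨0, _⟩ => simp [plist]; rfl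
        | ⟨1, _⟩ => simp [plist]; rfl
        | ⟨2, _⟩ => simp [plist]; rfl
    · exact (h 0 2).2 (by decide)
    · exact (h 2 1).2 (by decide)
  · rintro ⟨x, y, z, hs, h1, h2⟩
    rw [List.sublist_iff_exists_fin_orderEmbedding_get_eq] at hs
    obtain ⟨f, hf⟩ := hs
    have hl : (plist σ).length = n := by simp [plist]
    have e0 := hf ⟨0, by simp⟩
    have e1 := hf ⟨1, by simp⟩
    have e2 := hf ⟨2, by simp⟩
    simp [plist] at e0 e1 e2
    refine ⟨fun i => Fin.cast hl (f (Fin.cast rfl i)), ?_, ?_⟩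
    · intro i j hij
      have : f (Fin.cast rfl i) < f (Fin.cast rfl j) := f.strictMono hij
      simpa using this
    · rw [e0, e2] at h1
      rw [e2, e1] at h2
      intro i j
      have key : ∀ i : Fin 3, (i = 0 ∨ i = 1 ∨ i = 2) := by decide
      have g : ∀ i j : Fin 3, (pattern132 i < pattern132 j ↔
        (i = 0 ∧ j = 1) ∨ (i = 0 ∧ j = 2) ∨ (i = 2 ∧ j = 1)) := by decide
      rw [g]
      simp only [Fin.lt_def]
      rcases key i with rfl | rfl | rfl <;> rcases key j with rfl | rfl | rfl <;>
        simp <;> first | exact h1.trans h2 | exact h1 | exact h2 | exact h1.le | exact h2.le | exact (h1.trans h2).le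

lemma QcountZ_eq (n j k : ℕ) : QcountZ n (j + 1) (k + 1) =
    #{t ∈ BinaryTree.treesOfNumNodesEq n | (tlist 0 t)[j]? = some k} := by
  unfold QcountZ
  classical
  rw [Nat.card_eq_fintype_card, Fintype.card_subtype]
  rw [← Finset.card_image_of_injective (f := plist) _ (fun _ _ h => plist_inj h)]
  rw [← Finset.card_image_of_injective (f := tlist 0) _ (fun _ _ h => tlist_inj _ _ _ h)]
  congr 1
  have hget : ∀ σ : Equiv.Perm (Fin n), (plist σ)[j]? = some k ↔
      ∃ i : Fin n, ((i : ℕ) : ℤ) + 1 = (j : ℤ) + 1 ∧ ((σ i : ℕ) : ℤ) + 1 = (k : ℤ) + 1 := by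
    intro σ
    rw [List.getElem?_eq_some_iff]
    constructor
    · rintro ⟨h, h'⟩
      simp [plist] at h h'
      exact ⟨⟨j, h⟩, by simp, by simp [h']⟩
    · rintro ⟨i, h1, h2⟩
      have h1' : (i : ℕ) = j := by omega
      have h2' : ((σ i : Fin n) : ℕ) = k := by omega
      subst h1'
      exact ⟨by simp [plist], by simpa [plist] using h2'⟩
  ext l
  simp only [Finset.mem_image, Finset.mem_filter, Finset.mem_univ, true_and,
    BinaryTree.mem_treesOfNumNodesEq]
  constructor
  · rintro ⟨σ, ⟨h1, h2⟩, rfl⟩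
    rw [avoids_iff] at h1
    rw [← hget] at h2
    obtain ⟨t, ht, ht'⟩ := tlist_surj n 0 _ (plist_perm σ) h1
    exact ⟨t, ⟨ht, ht' ▸ h2⟩, ht'⟩
  · rintro ⟨t, ⟨h1, h2⟩, rfl⟩
    have hp := tlist_perm t 0
    rw [h1] at hp
    obtain ⟨σ, hσ⟩ := plist_surj hp
    refine ⟨σ, ⟨?_, ?_⟩, hσ⟩
    · rw [avoids_iff, hσ]; exact tlist_LAv _ _
    · rw [← hget, hσ]; exact h2

section GF
variable {S : Type*} [CommRing S] (x y : S)

/-- Generating polynomial of a list. -/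
def lwt : List ℕ → S
  | [] => 0
  | a :: l => y ^ a + x * lwt l

lemma lwt_append (l l' : List ℕ) : lwt x y (l ++ l') = lwt x y l + x ^ l.length * lwt x y l' := by
  induction l with
  | nil => simp [lwt]
  | cons a l ih => simp [lwt, ih]; ring

lemma lwt_map (l : List ℕ) (b : ℕ) : lwt x y (l.map (· + b)) = y ^ b * lwt x y l := by
  induction l with
  | nil => simp [lwt]
  | cons a l ih => simp only [List.map_cons, lwt, ih]; ring

lemma lwt_node (l r : BinaryTree Unit) : lwt x y (tlist 0 (.node () l r)) =
    y ^ r.numNodes * lwt x y (tlist 0 l) + x ^ l.numNodes * y ^ (l.numNodes + r.numNodes)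
      + x ^ (l.numNodes + 1) * lwt x y (tlist 0 r) := by
  simp only [tlist]
  rw [lwt_append, tlist_length, tlist_map l, lwt_map]
  simp only [lwt]
  ring

/-- Generating polynomial of all trees of size `n`. -/
def Qp (n : ℕ) : S := ∑ t ∈ BinaryTree.treesOfNumNodesEq n, lwt x y (tlist 0 t)

lemma Qp_succ (n : ℕ) : Qp x y (n + 1) = ∑ ij ∈ antidiagonal n,
    ((catalan ij.2 : S) * y ^ ij.2 * Qp x y ij.1 +
      (catalan ij.1 : S) * (x * y) ^ ij.1 * ((catalan ij.2 : S) * y ^ ij.2) +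
      x * ((catalan ij.1 : S) * x ^ ij.1 * Qp x y ij.2)) := by
  unfold Qp
  rw [BinaryTree.treesOfNumNodesEq_succ, sum_biUnion]
  · apply sum_congr rfl
    rintro ⟨i, j⟩ -
    simp only [BinaryTree.pairwiseNode]
    rw [sum_map, sum_product]
    have : ∀ a ∈ BinaryTree.treesOfNumNodesEq i, ∀ b ∈ BinaryTree.treesOfNumNodesEq j,
        lwt x y (tlist 0 (.node () a b)) = y ^ j * lwt x y (tlist 0 a) + x ^ i * y ^ (i + j)
      + x ^ (i + 1) * lwt x y (tlist 0 b) := by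
      intro a ha b hb
      rw [BinaryTree.mem_treesOfNumNodesEq] at ha hb
      rw [lwt_node, ha, hb]
    refine (sum_congr rfl fun a ha => sum_congr rfl fun b hb => this a ha b hb).trans ?_
    simp only [sum_add_distrib, sum_const, ← mul_sum, nsmul_eq_mul,
      BinaryTree.treesOfNumNodesEq_card_eq_catalan]
    ring
  · simp_rw [Set.PairwiseDisjoint, Set.Pairwise, disjoint_left]
    aesop

open PowerSeries in
/-- `C(u z)` -/
noncomputable def Cs (u : S) : PowerSeries S := PowerSeries.mk (fun n => (catalan n : S) * u ^ n)

open PowerSeries in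
lemma Cs_eq (u : S) : Cs u = 1 + X * C u * Cs u ^ 2 := by
  ext n
  cases n with
  | zero => simp [Cs]
  | succ n =>
    rw [mul_assoc, map_add, coeff_succ_X_mul, coeff_C_mul, sq, coeff_mul, coeff_one]
    simp only [Cs, coeff_mk, catalan_succ', Nat.succ_ne_zero, if_false, zero_add, Nat.cast_sum,
      sum_mul, mul_sum, Nat.cast_mul]
    apply sum_congr rfl
    intro ij hij
    rw [HasAntidiagonal.mem_antidiagonal] at hij
    simp only [← hij]
    ring

open PowerSeries in
lemma Qs_rec : PowerSeries.mk (Qp x y) = X * (PowerSeries.mk (Qp x y) * Cs y + Cs (x * y) * Cs y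
    + C x * (Cs x * PowerSeries.mk (Qp x y))) := by
  ext n
  cases n with
  | zero => simp [Qp, tlist, lwt]
  | succ n =>
    rw [coeff_succ_X_mul, coeff_mk, Qp_succ]
    rw [map_add, map_add, coeff_C_mul]
    simp only [coeff_mul, Cs, coeff_mk, sum_add_distrib, mul_sum]
    congr 2
    apply sum_congr rfl
    intros; ring

open PowerSeries in
lemma Qs_eq : PowerSeries.mk (Qp x y) = X * Cs (x * y) * (Cs x * Cs y) +
    X * (Cs x * Cs y) * PowerSeries.mk (Qp x y) := by
  have h1 := Cs_eq x
  have h2 := Qs_rec x y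
  set Q := PowerSeries.mk (Qp x y)
  linear_combination (1 * Cs x) * h2 - Q * h1

open PowerSeries in
lemma Qs_iter (N : ℕ) : PowerSeries.mk (Qp x y) =
    ∑ s ∈ range N, X ^ (s + 1) * (Cs (x * y) * (Cs x ^ (s + 1) * Cs y ^ (s + 1))) +
    X ^ N * ((Cs x * Cs y) ^ N * PowerSeries.mk (Qp x y)) := by
  induction N with
  | zero => simp
  | succ N ih =>
    rw [sum_range_succ]
    have h := Qs_eq x y
    set Q := PowerSeries.mk (Qp x y)
    linear_combination ih + X ^ N * (Cs x * Cs y) ^ N * h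

/-- ballot numbers -/
noncomputable def bal (s p : ℕ) : ℤ := PowerSeries.coeff p ((Cs (1 : ℤ)) ^ s)

open PowerSeries in
lemma Cs_pow_coeff (u : S) (s p : ℕ) : coeff p (Cs u ^ s) = (bal s p : S) * u ^ p := by
  have : Cs u = rescale u (PowerSeries.map (Int.castRingHom S) (Cs 1)) := by
    ext n; simp [Cs, coeff_rescale]; ring
  rw [this, ← map_pow, ← map_pow, coeff_rescale, coeff_map]
  simp [bal, mul_comm]

open PowerSeries in
lemma Qp_eq (n : ℕ) : Qp x y n = ∑ s ∈ range n, ∑ a ∈ antidiagonal (n - 1 - s),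
    ∑ b ∈ antidiagonal a.2, ((catalan a.1 * bal (s + 1) b.1 * bal (s + 1) b.2 : ℤ) : S) *
      (x ^ (a.1 + b.1) * y ^ (a.1 + b.2)) := by
  have h := congrArg (coeff n) (Qs_iter x y (n + 1))
  rw [coeff_mk, map_add, coeff_X_pow_mul', if_neg (by omega), add_zero, sum_range_succ, map_add,
    coeff_X_pow_mul', if_neg (by omega), add_zero, map_sum] at h
  rw [h]
  apply sum_congr rfl
  intro s hs
  rw [mem_range] at hs
  rw [coeff_X_pow_mul', if_pos (by omega), coeff_mul, show n - (s + 1) = n - 1 - s by omega]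
  apply sum_congr rfl
  intro a _
  rw [coeff_mul, mul_sum]
  apply sum_congr rfl
  intro b _
  rw [Cs_pow_coeff, Cs_pow_coeff, Cs, coeff_mk]
  push_cast
  ring

end GF

open Polynomial in
lemma lwt_coeff (l : List ℕ) : ∀ j k : ℕ, ((lwt (C X : ℤ[X][X]) X l).coeff k).coeff j =
    if l[j]? = some k then 1 else 0 := by
  induction l with
  | nil => simp [lwt]
  | cons a l ih =>
    intro j k
    rw [lwt, coeff_add, coeff_C_mul, coeff_add, coeff_X_pow]
    cases j with
    | zero =>
      simp [eq_comm]
      split_ifs <;> simp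
    | succ j =>
      rw [coeff_X_mul, ih]
      simp
      split_ifs <;> simp [coeff_one]

open Polynomial in
lemma QcountZ_eq_coeff (n j k : ℕ) : (QcountZ n (j + 1) (k + 1) : ℤ) =
    ((Qp (C X : ℤ[X][X]) X n).coeff k).coeff j := by
  rw [QcountZ_eq, Qp, finsetSum_coeff, finsetSum_coeff]
  simp [lwt_coeff]

/-- summand -/
noncomputable def Tm (n j k r : ℕ) : ℤ :=
  if r ≤ j ∧ r ≤ k ∧ j + k + 1 ≤ n + r then
    catalan r * bal (n + r - j - k) (j - r) * bal (n + r - j - k) (k - r) else 0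

open Polynomial in
lemma QcountZ_formula (n j k : ℕ) : (QcountZ n (j + 1) (k + 1) : ℤ) = ∑ r ∈ range n, Tm n j k r := by
  rw [QcountZ_eq_coeff, Qp_eq]
  have hc : ∀ (c : ℤ) (u v : ℕ), (((c : ℤ[X][X]) * ((C X) ^ u * X ^ v)).coeff k).coeff j =
      if u = j ∧ v = k then c else 0 := by
    intro c u v
    rw [show (c : ℤ[X][X]) = C (C c) by simp, ← C_pow, ← mul_assoc, ← C_mul, coeff_C_mul,
      coeff_X_pow]
    by_cases h : v = k
    · subst h
      simp [coeff_X_pow, eq_comm]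
    · rw [if_neg (Ne.symm h)]; simp [h]
  simp only [finsetSum_coeff, hc]
  unfold Tm
  rw [sum_sigma', sum_sigma', ← sum_filter, ← sum_filter]
  refine sum_nbij' (fun z => z.1.2.1)
    (fun r => ⟨⟨n + r - j - k - 1, (r, (j - r) + (k - r))⟩, (j - r, k - r)⟩) ?_ ?_ ?_ ?_ ?_
  · rintro ⟨⟨s, a1, a2⟩, b1, b2⟩ h
    simp only [mem_filter, mem_sigma, mem_range, HasAntidiagonal.mem_antidiagonal] at h ⊢
    omega
  · intro r h
    simp only [mem_filter, mem_sigma, mem_range, HasAntidiagonal.mem_antidiagonal] at h ⊢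
    refine ⟨⟨⟨?_, ?_⟩, ?_⟩, ?_, ?_⟩ <;> first | trivial | omega
  · rintro ⟨⟨s, a1, a2⟩, b1, b2⟩ h
    simp only [mem_filter, mem_sigma, mem_range, HasAntidiagonal.mem_antidiagonal] at h ⊢
    have e1 : n + a1 - j - k - 1 = s := by omega
    have e2 : j - a1 = b1 := by omega
    have e3 : k - a1 = b2 := by omega
    rw [e1, e2, e3, h.1.2]
  · intro r h
    rfl
  · rintro ⟨⟨s, a1, a2⟩, b1, b2⟩ h
    simp only [mem_filter, mem_sigma, mem_range, HasAntidiagonal.mem_antidiagonal] at h ⊢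
    have e1 : n + a1 - j - k = s + 1 := by omega
    have e2 : j - a1 = b1 := by omega
    have e3 : k - a1 = b2 := by omega
    rw [e1, e2, e3]

lemma bal_zero (p : ℕ) : bal 0 (p + 1) = 0 := by
  simp [bal, PowerSeries.coeff_one]

lemma bal_one (p : ℕ) : bal 1 p = catalan p := by
  simp [bal, Cs]

open PowerSeries in
lemma bal_rec (s p : ℕ) : bal (s + 2) p = bal (s + 1) (p + 1) - bal s (p + 1) := by
  have h : Cs (1 : ℤ) ^ (s + 1) = Cs 1 ^ s + X * Cs 1 ^ (s + 2) := by
    have := Cs_eq (1 : ℤ)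
    simp only [map_one, mul_one] at this
    linear_combination Cs 1 ^ s * this
  have := congrArg (coeff (p + 1)) h
  rw [map_add, coeff_succ_X_mul] at this
  unfold bal
  linarith

open Nat in
lemma bal_fact (s : ℕ) : ∀ p, bal (s + 1) p * (p ! * (p + s + 1)! : ℕ) = ((s + 1) * (2 * p + s)! : ℕ) := by
  have h1 : ∀ p, bal 1 p * (p ! * (p + 1)! : ℕ) = ((2 * p)! : ℕ) := by
    intro p
    rw [bal_one]
    have h := succ_mul_catalan_eq_centralBinom p
    have h2 : centralBinom p * (p ! * p !) = (2 * p)! := by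
      have := Nat.choose_mul_factorial_mul_factorial (n := 2 * p) (k := p) (by omega)
      rw [Nat.centralBinom, ← this, show 2 * p - p = p by omega]; ring
    norm_cast
    rw [← h2, ← h, Nat.factorial_succ]; ring
  induction s using Nat.strong_induction_on with
  | _ s ih =>
    intro p
    match s, ih with
    | 0, _ => simpa using h1 p
    | 1, _ =>
      have := h1 (p + 1)
      rw [bal_rec 0 p, bal_zero, sub_zero]
      have e : (p + 1)! = (p + 1) * p ! := Nat.factorial_succ p
      have e2 : (2 * (p + 1))! = (2 * p + 2) * (2 * p + 1)! := Nat.factorial_succ (2 * p + 1)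
      rw [e, e2] at this
      push_cast at this ⊢
      have hp : (p + 1 : ℤ) ≠ 0 := by positivity
      apply mul_left_cancel₀ hp
      simp only [add_assoc] at this ⊢
      linarith
    | s + 2, ih =>
      have i1 := ih (s + 1) (by omega) (p + 1)
      have i0 := ih s (by omega) (p + 1)
      rw [bal_rec (s + 1) p]
      have e : (p + 1)! = (p + 1) * p ! := Nat.factorial_succ p
      have e2 : (2 * (p + 1) + (s + 1))! = (2 * p + s + 3) * (2 * p + s + 2)! := by
        rw [show 2 * (p + 1) + (s + 1) = 2 * p + s + 2 + 1 by ring, Nat.factorial_succ]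
      have e3 : (p + 1 + (s + 1) + 1)! = (p + s + 3) * (p + s + 2)! := by
        rw [show p + 1 + (s + 1) + 1 = p + s + 2 + 1 by ring, Nat.factorial_succ]
      have e4 : (p + (s + 2) + 1)! = (p + s + 3) * (p + s + 2)! := by
        rw [show p + (s + 2) + 1 = p + s + 2 + 1 by ring, Nat.factorial_succ]
      rw [e, e2, e3] at i1
      rw [show p + 1 + s + 1 = p + s + 2 by ring, show 2 * (p + 1) + s = 2 * p + s + 2 by ring, e] at i0
      rw [e4, show 2 * p + (s + 2) = 2 * p + s + 2 by ring]
      push_cast at i0 i1 ⊢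
      have hp : (p + 1 : ℤ) ≠ 0 := by positivity
      apply mul_left_cancel₀ hp
      linear_combination i1 - (p + s + 3) * i0

lemma bal_choose (s p : ℕ) : (bal (s + 1) p : ℝ) =
    ((s + 1 : ℕ) : ℝ) / ((2 * p + (s + 1) : ℕ) : ℝ) * (Nat.choose (2 * p + (s + 1)) p : ℝ) := by
  have h := bal_fact s p
  have h2 := Nat.choose_mul_factorial_mul_factorial (n := 2 * p + (s + 1)) (k := p) (by omega)
  rw [show 2 * p + (s + 1) - p = p + s + 1 by omega, show 2 * p + (s + 1) = (2 * p + s) + 1 by ring,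
    Nat.factorial_succ] at h2
  rw [show 2 * p + (s + 1) = (2 * p + s) + 1 by ring]
  have h' : (bal (s + 1) p : ℝ) * ((p.factorial : ℝ) * ((p + s + 1).factorial : ℝ)) =
    (s + 1) * ((2 * p + s).factorial : ℝ) := by exact_mod_cast h
  have h2' : (Nat.choose (2 * p + s + 1) p : ℝ) * (p.factorial : ℝ) * ((p + s + 1).factorial : ℝ) =
    (2 * p + s + 1) * ((2 * p + s).factorial : ℝ) := by exact_mod_cast h2
  have f1 : (p.factorial : ℝ) ≠ 0 := by positivity
  have f2 : ((p + s + 1).factorial : ℝ) ≠ 0 := by positivity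
  have hN : (2 * (p : ℝ) + s + 1) ≠ 0 := by positivity
  push_cast
  rw [div_mul_eq_mul_div, eq_div_iff hN]
  apply mul_right_cancel₀ f1
  apply mul_right_cancel₀ f2
  linear_combination (2 * (p : ℝ) + s + 1) * h' - (s + 1) * h2'

lemma centralBinom_sq_le (m : ℕ) : (2 * (m : ℝ) + 1) * (Nat.centralBinom m : ℝ) ^ 2 ≤ 16 ^ m := by
  induction m with
  | zero => simp
  | succ m ih =>
    have h : ((m : ℝ) + 1) * (Nat.centralBinom (m + 1) : ℝ) =
        2 * (2 * m + 1) * (Nat.centralBinom m : ℝ) := by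
      exact_mod_cast Nat.succ_mul_centralBinom_succ m
    have hm : (0 : ℝ) ≤ m := Nat.cast_nonneg m
    set c := (Nat.centralBinom m : ℝ)
    set c' := (Nat.centralBinom (m + 1) : ℝ)
    have hc' : c' = 2 * (2 * m + 1) * c / (m + 1) := by
      rw [eq_div_iff (by positivity)]; linarith
    rw [hc', pow_succ 16 m, div_pow, mul_div_assoc', div_le_iff₀ (by positivity)]
    push_cast
    have hc : 0 ≤ c ^ 2 := sq_nonneg c
    calc (2 * ((m : ℝ) + 1) + 1) * (2 * (2 * m + 1) * c) ^ 2
        = 4 * ((2 * m + 1) * (2 * m + 3)) * ((2 * m + 1) * c ^ 2) := by ring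
      _ ≤ 4 * (2 * m + 2) ^ 2 * ((2 * m + 1) * c ^ 2) := by
          apply mul_le_mul_of_nonneg_right _ (by positivity); nlinarith
      _ ≤ 4 * (2 * m + 2) ^ 2 * 16 ^ m := by
          apply mul_le_mul_of_nonneg_left ih (by positivity)
      _ = 16 ^ m * 16 * (m + 1) ^ 2 := by ring

lemma choose_half_le (N : ℕ) : ((N : ℝ) + 1) * (Nat.choose N (N / 2) : ℝ) ^ 2 ≤ 4 ^ N := by
  obtain ⟨m, rfl | rfl⟩ := Nat.even_or_odd' N
  · have := centralBinom_sq_le m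
    rw [Nat.centralBinom] at this
    rw [show 2 * m / 2 = m by omega, pow_mul]
    push_cast
    norm_num
    exact this
  · have := centralBinom_sq_le (m + 1)
    have e : (Nat.centralBinom (m + 1) : ℝ) = 2 * (Nat.choose (2 * m + 1) m : ℝ) := by
      rw [Nat.centralBinom, show 2 * (m + 1) = 2 * m + 1 + 1 by ring, Nat.choose_succ_succ,
        Nat.choose_symm_half]; push_cast; ring
    rw [e, pow_succ 16 m] at this
    rw [show (2 * m + 1) / 2 = m by omega, pow_succ 4 (2 * m), pow_mul]
    push_cast at this ⊢
    norm_num at this ⊢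
    nlinarith [sq_nonneg (Nat.choose (2 * m + 1) m : ℝ)]

lemma choose_decay (N p h : ℕ) (hN : N = 2 * p + h) : (Nat.choose N p : ℝ) ≤
    Nat.choose N (N / 2) * exp (1 / 4) * exp (-(h : ℝ) ^ 2 / (4 * (N + 1))) := by
  have hN0 : (0 : ℝ) < (N : ℝ) + 1 := by positivity
  have key : ∀ h p : ℕ, N = 2 * p + h → (Nat.choose N p : ℝ) ≤
      Nat.choose N (N / 2) * exp (-((h : ℝ) ^ 2 - 1) / (4 * (N + 1))) := by
    intro h
    induction h using Nat.strong_induction_on with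
    | _ h ih =>
      intro p hp
      by_cases h2 : h < 2
      · have : N / 2 = p := by omega
        rw [this]
        apply le_mul_of_one_le_right (by positivity)
        rw [one_le_exp_iff]
        apply div_nonneg _ (by positivity)
        have : (h : ℝ) ≤ 1 := by exact_mod_cast (by omega : h ≤ 1)
        have h0 : (0 : ℝ) ≤ h := by positivity
        nlinarith
      · obtain ⟨g, rfl⟩ : ∃ g, h = g + 2 := ⟨h - 2, by omega⟩
        have i := ih g (by omega) (p + 1) (by omega)
        have e := Nat.choose_succ_right_eq N p
        have e' : (Nat.choose N (p + 1) : ℝ) * (p + 1) = Nat.choose N p * (p + g + 2) := by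
          rw [show N - p = p + g + 2 by omega] at e
          exact_mod_cast e
        have hNr : (N : ℝ) = 2 * p + (g + 2) := by exact_mod_cast hp
        have e2 : (Nat.choose N p : ℝ) = Nat.choose N (p + 1) * ((p + 1) / (p + g + 2)) := by
          rw [mul_div_assoc', e']; field_simp
        have b : ((p : ℝ) + 1) / (p + g + 2) ≤ exp (-((g : ℝ) + 1) / (N + 1)) := by
          have := add_one_le_exp (-((g : ℝ) + 1) / (N + 1))
          refine le_trans ?_ this
          rw [div_add_one hN0.ne', div_le_div_iff₀ (by positivity) hN0, hNr]
          have : (0 : ℝ) ≤ p := by positivity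
          have : (0 : ℝ) ≤ g := by positivity
          nlinarith
        rw [e2]
        calc _ ≤ (Nat.choose N (N / 2) * exp (-((g : ℝ) ^ 2 - 1) / (4 * (N + 1)))) *
              exp (-((g : ℝ) + 1) / (N + 1)) := by gcongr
          _ = _ := by
            rw [mul_assoc, ← exp_add]
            congr 2
            push_cast
            field_simp
            ring
  refine (key h p hN).trans ?_
  rw [mul_assoc, ← exp_add]
  gcongr
  have : (0 : ℝ) ≤ N := by positivity
  rw [div_add_div _ _ (by norm_num) (by positivity), div_le_div_iff₀ (by positivity) (by positivity)]
  nlinarith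

/-- normalised binomial -/
noncomputable def nb (N p : ℕ) : ℝ := √N * Nat.choose N p / 2 ^ N

lemma nb_nonneg (N p : ℕ) : 0 ≤ nb N p := by unfold nb; positivity

lemma nb_le (N p h : ℕ) (hN : N = 2 * p + h) :
    nb N p ≤ exp (1 / 4) * exp (-(h : ℝ) ^ 2 / (4 * (N + 1))) := by
  have h1 := choose_decay N p h hN
  have h2 := choose_half_le N
  have h3 : √N * Nat.choose N (N / 2) ≤ 2 ^ N := by
    apply le_of_sq_le_sq _ (by positivity)
    rw [mul_pow, sq_sqrt (by positivity), ← pow_mul, mul_comm N 2, pow_mul]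
    norm_num
    nlinarith [sq_nonneg (Nat.choose N (N / 2) : ℝ)]
  unfold nb
  rw [div_le_iff₀ (by positivity)]
  calc √N * Nat.choose N p ≤ √N * (Nat.choose N (N / 2) * exp (1 / 4) * exp (-(h : ℝ) ^ 2 / (4 * (N + 1)))) := by gcongr
    _ = (√N * Nat.choose N (N / 2)) * (exp (1 / 4) * exp (-(h : ℝ) ^ 2 / (4 * (N + 1)))) := by ring
    _ ≤ 2 ^ N * (exp (1 / 4) * exp (-(h : ℝ) ^ 2 / (4 * (N + 1)))) := by gcongr
    _ = _ := by ring

lemma catalan_le (r : ℕ) : (catalan r : ℝ) / 4 ^ r ≤ ((r : ℝ) + 1) ^ (-(3 / 2) : ℝ) := by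
  have h := centralBinom_sq_le r
  have h2 : ((r : ℝ) + 1) * catalan r = Nat.centralBinom r := by
    exact_mod_cast succ_mul_catalan_eq_centralBinom r
  have hr : (0 : ℝ) ≤ r := by positivity
  rw [← h2] at h
  apply le_of_sq_le_sq _ (by positivity)
  rw [← rpow_natCast (((r : ℝ) + 1) ^ (-(3 / 2) : ℝ)) 2, ← rpow_mul (by positivity)]
  norm_num
  rw [div_pow, div_le_iff₀ (by positivity), inv_mul_eq_div,
    le_div_iff₀ (by positivity), ← pow_mul, mul_comm r 2, pow_mul]
  norm_num
  nlinarith [mul_nonneg hr (sq_nonneg (((r : ℝ) + 1) * catalan r))]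

/-- entropy-type function -/
noncomputable def phiE (y : ℝ) : ℝ := (1 - y) * log (1 - y) + (1 + y) * log (1 + y)

lemma phiE_approx {y : ℝ} (hy : |y| ≤ 1 / 2) : |phiE y - y ^ 2| ≤ 8 * |y| ^ 3 := by
  have h1 := abs_log_sub_add_sum_range_le (x := y) (by linarith) 2
  have h2 := abs_log_sub_add_sum_range_le (x := -y) (by rw [abs_neg]; linarith) 2
  rw [abs_neg] at h2
  simp only [sum_range_succ, range_zero, sum_empty] at h1 h2
  norm_num at h1 h2
  have hd : |y| ^ 3 / (1 - |y|) ≤ 2 * |y| ^ 3 := by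
    rw [div_le_iff₀ (by linarith)]
    have : 0 ≤ |y| ^ 3 := by positivity
    nlinarith
  have h1' := h1.trans hd
  have h2' := h2.trans hd
  have e : phiE y - y ^ 2 = (1 - y) * (y + y ^ 2 / 2 + log (1 - y)) +
      (1 + y) * (-y + y ^ 2 / 2 + log (1 + y)) := by
    unfold phiE; ring
  rw [e]
  refine (abs_add_le _ _).trans ?_
  rw [abs_mul, abs_mul]
  have a1 : |1 - y| ≤ 2 := by rw [abs_le] at hy ⊢; constructor <;> linarith
  have a2 : |1 + y| ≤ 2 := by rw [abs_le] at hy ⊢; constructor <;> linarith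
  have b1 := mul_le_mul a1 h1' (abs_nonneg _) (by norm_num)
  have b2 := mul_le_mul a2 h2' (abs_nonneg _) (by norm_num)
  linarith

lemma fact_stirling (n : ℕ) (hn : n ≠ 0) : (n.factorial : ℝ) =
    Stirling.stirlingSeq n * (√2 * √n) * exp (n * log n - n) := by
  have hn' : (0 : ℝ) < n := by exact_mod_cast Nat.pos_of_ne_zero hn
  have : exp (n * log n - n) = (n / exp 1) ^ n := by
    rw [← exp_log (show (0 : ℝ) < (n / exp 1) ^ n by positivity), log_pow, log_div hn'.ne' (exp_ne_zero 1),
      log_exp]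
    ring_nf
  rw [this, Stirling.stirlingSeq, ← sqrt_mul (by norm_num)]
  field_simp

lemma nb_eq (p h : ℕ) (hp : p ≠ 0) : nb (2 * p + h) p =
    Stirling.stirlingSeq (2 * p + h) / (Stirling.stirlingSeq p * Stirling.stirlingSeq (p + h)) *
      (1 / √2) * (2 / √((1 - h / (2 * p + h : ℕ)) * (1 + h / (2 * p + h : ℕ)))) *
      exp (-((2 * p + h : ℕ) : ℝ) / 2 * phiE (h / (2 * p + h : ℕ))) := by
  have hch := Nat.choose_mul_factorial_mul_factorial (n := 2 * p + h) (k := p) (by omega)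
  rw [show 2 * p + h - p = p + h by omega] at hch
  have hch' : ((2 * p + h).choose p : ℝ) * p.factorial * (p + h).factorial =
    (2 * p + h).factorial := by exact_mod_cast hch
  have sp : 0 < Stirling.stirlingSeq p := by
    obtain ⟨m, rfl⟩ := Nat.exists_eq_succ_of_ne_zero hp; exact Stirling.stirlingSeq'_pos m
  have sq : 0 < Stirling.stirlingSeq (p + h) := by
    obtain ⟨m, hm⟩ := Nat.exists_eq_succ_of_ne_zero (show p + h ≠ 0 by omega)
    rw [hm]; exact Stirling.stirlingSeq'_pos m
  rw [fact_stirling p hp, fact_stirling (p + h) (by omega), fact_stirling (2 * p + h) (by omega)] at hch'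
  have hN : ((2 * p + h : ℕ) : ℝ) = p + (p + h : ℕ) := by push_cast; ring
  have hpr : (0 : ℝ) < p := by exact_mod_cast Nat.pos_of_ne_zero hp
  have hqr : (0 : ℝ) < (p + h : ℕ) := by exact_mod_cast (by omega : 0 < p + h)
  have hhr : (h : ℝ) = (p + h : ℕ) - p := by push_cast; ring
  unfold nb
  rw [← rpow_natCast 2 (2 * p + h), rpow_def_of_pos (by norm_num)]
  set N : ℝ := ((2 * p + h : ℕ) : ℝ) with hNdef
  set q : ℝ := ((p + h : ℕ) : ℝ)
  have hN0 : 0 < N := by rw [hN]; positivity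
  have e1 : 1 - (h : ℝ) / N = 2 * p / N := by rw [hhr, hN]; field_simp; ring
  have e2 : 1 + (h : ℝ) / N = 2 * q / N := by rw [hhr, hN]; field_simp; ring
  rw [phiE, e1, e2]
  have e3 : √(2 * p / N * (2 * q / N)) = 2 * √p * √q / N := by
    rw [show 2 * p / N * (2 * q / N) = (2 / N) ^ 2 * (p * q) by field_simp,
      sqrt_mul (by positivity), sqrt_sq (by positivity), sqrt_mul hpr.le]; ring
  rw [e3, log_div (by positivity) hN0.ne', log_div (by positivity) hN0.ne',
    log_mul (by norm_num) hpr.ne', log_mul (by norm_num) hqr.ne']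
  have e4 : exp (-N / 2 * (2 * p / N * (log 2 + log p - log N) + 2 * q / N * (log 2 + log q - log N))) =
      exp (N * log N - N) / (exp (p * log p - p) * exp (q * log q - q)) / exp (log 2 * N) := by
    rw [← exp_add, ← exp_sub, ← exp_sub]
    congr 1
    rw [hN] at *
    field_simp
    ring
  rw [e4]
  set E1 := exp (N * log N - N)
  set E2 := exp (p * log p - p) with hE2
  set E3 := exp (q * log q - q) with hE3
  have hE2p : 0 < E2 := exp_pos _
  have hE3p : 0 < E3 := exp_pos _
  have hsp : 0 < √(p : ℝ) := sqrt_pos.2 hpr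
  have hsq : 0 < √q := sqrt_pos.2 hqr
  have hsN : √N * √N = N := mul_self_sqrt hN0.le
  have h2p : (0 : ℝ) < √2 := by positivity
  have hc : ((2 * p + h).choose p : ℝ) = Stirling.stirlingSeq (2 * p + h) * (√2 * √N) * E1 /
     ((Stirling.stirlingSeq p * (√2 * √p) * E2) * (Stirling.stirlingSeq (p + h) * (√2 * √q) * E3)) := by
    rw [eq_div_iff (by positivity), ← hch']; ring
  rw [hc]
  field_simp
  rw [sq_sqrt hN0.le]
  ring

lemma nb_tendsto {ι : Type*} {l : Filter ι} (p h : ι → ℕ) (x : ℝ) (hp : Tendsto p l atTop)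
    (hx : Tendsto (fun i => (h i : ℝ) / √((2 * p i + h i : ℕ) : ℝ)) l (nhds x)) :
    Tendsto (fun i => nb (2 * p i + h i) (p i)) l (nhds (√2 / √π * exp (-x ^ 2 / 2))) := by
  have hq : Tendsto (fun i => p i + h i) l atTop := tendsto_atTop_mono (fun i => by omega) hp
  have hNn : Tendsto (fun i => 2 * p i + h i) l atTop := tendsto_atTop_mono (fun i => by omega) hp
  have hN : Tendsto (fun i => ((2 * p i + h i : ℕ) : ℝ)) l atTop :=
    tendsto_natCast_atTop_atTop.comp hNn
  have hsN : Tendsto (fun i => √((2 * p i + h i : ℕ) : ℝ)) l atTop := tendsto_sqrt_atTop.comp hN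
  have hy : Tendsto (fun i => (h i : ℝ) / ((2 * p i + h i : ℕ) : ℝ)) l (nhds 0) := by
    have := hx.mul hsN.inv_tendsto_atTop
    rw [mul_zero] at this
    refine this.congr fun i => ?_
    simp only [Pi.inv_apply]
    rw [← div_eq_mul_inv, div_div, mul_self_sqrt (by positivity)]
  have S := Stirling.tendsto_stirlingSeq_sqrt_pi
  have hpi : 0 < √π := sqrt_pos.2 pi_pos
  have hS := (S.comp hNn).div ((S.comp hp).mul (S.comp hq)) (by positivity)
  have hR : Tendsto (fun i => 2 / √((1 - (h i : ℝ) / ((2 * p i + h i : ℕ) : ℝ)) *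
      (1 + (h i : ℝ) / ((2 * p i + h i : ℕ) : ℝ)))) l (nhds (2 / √((1 - 0) * (1 + 0)))) := by
    refine tendsto_const_nhds.div ?_ (by simp)
    exact (continuous_sqrt.tendsto _).comp ((tendsto_const_nhds.sub hy).mul (tendsto_const_nhds.add hy))
  have hNy2 : Tendsto (fun i => ((2 * p i + h i : ℕ) : ℝ) *
      ((h i : ℝ) / ((2 * p i + h i : ℕ) : ℝ)) ^ 2) l (nhds (x ^ 2)) := by
    refine (hx.pow 2).congr' ?_
    filter_upwards [hN.eventually_gt_atTop 0] with i hi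
    rw [div_pow, sq_sqrt hi.le]
    field_simp
  have hE : Tendsto (fun i => -((2 * p i + h i : ℕ) : ℝ) / 2 *
      phiE ((h i : ℝ) / ((2 * p i + h i : ℕ) : ℝ))) l (nhds (-x ^ 2 / 2)) := by
    have hz : Tendsto (fun i => ((2 * p i + h i : ℕ) : ℝ) *
        (phiE ((h i : ℝ) / ((2 * p i + h i : ℕ) : ℝ)) -
          ((h i : ℝ) / ((2 * p i + h i : ℕ) : ℝ)) ^ 2)) l (nhds 0) := by
      have hb := (hNy2.mul hy.abs).const_mul 8
      rw [abs_zero, mul_zero, mul_zero] at hb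
      refine squeeze_zero_norm' ?_ hb
      have : ∀ᶠ i in l, |(h i : ℝ) / ((2 * p i + h i : ℕ) : ℝ)| ≤ 1 / 2 := by
        have := hy.abs
        rw [abs_zero] at this
        exact (this.eventually_lt_const (show (0 : ℝ) < 1 / 2 by norm_num)).mono fun _ h => h.le
      filter_upwards [this] with i hi
      have := phiE_approx hi
      rw [Real.norm_eq_abs, abs_mul, abs_of_nonneg (Nat.cast_nonneg (α := ℝ) _)]
      refine (mul_le_mul_of_nonneg_left this (Nat.cast_nonneg _)).trans (le_of_eq ?_)
      rw [← sq_abs]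
      ring
    have := (hz.add hNy2).const_mul (-(1 / 2))
    convert this using 1
    · ext i; ring
    · congr 1; ring
  have hE' := (continuous_exp.tendsto _).comp hE
  have := ((hS.mul_const (1 / √2)).mul hR).mul hE'
  convert this.congr' ?_ using 1
  · congr 2
    have h2 : √2 * √2 = (2 : ℝ) := mul_self_sqrt (by norm_num)
    simp only [sub_zero, add_zero, mul_one, sqrt_one, div_one]
    field_simp
    rw [sq, h2]
  · filter_upwards [hp.eventually_ne_atTop 0] with i hi
    rw [nb_eq _ _ hi]
    rfl

/-- Catalan asymptotics. -/
lemma catalan_tendsto : Tendsto (fun r : ℕ => (r : ℝ) ^ (3 / 2 : ℝ) * (catalan r : ℝ) / 4 ^ r) atTop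
    (nhds (1 / √π)) := by
  have h := nb_tendsto (l := atTop) (fun r : ℕ => r) (fun _ => 0) 0 tendsto_id (by simp)
  have h1 : Tendsto (fun r : ℕ => (r : ℝ) / (r + 1)) atTop (nhds 1) :=
    tendsto_natCast_div_add_atTop 1
  have := (h.mul h1).mul_const (1 / √2)
  convert this.congr' ?_ using 1
  · have : 0 < √(2 : ℝ) := by positivity
    congr 1
    simp
    field_simp
  · filter_upwards [eventually_gt_atTop 0] with r hr
    have hr' : (0 : ℝ) < r := by exact_mod_cast hr
    have h2 : ((r : ℝ) + 1) * catalan r = Nat.centralBinom r := by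
      exact_mod_cast succ_mul_catalan_eq_centralBinom r
    rw [nb]
    simp only [add_zero]
    rw [← Nat.centralBinom, ← h2, pow_mul]
    push_cast
    rw [sqrt_mul (by norm_num), show (3 / 2 : ℝ) = 1 + 1 / 2 by norm_num, rpow_add hr', rpow_one,
      ← sqrt_eq_rpow]
    norm_num
    field_simp

open MeasureTheory in
lemma sum_eq_integral (T : ℕ → ℝ) (M : ℕ) (hT : ∀ r, M ≤ r → T r = 0) (s : ℝ) (hs : 0 < s) :
    ∫ t in Set.Ioi (0 : ℝ), T ⌊t * s⌋₊ = s⁻¹ * ∑ r ∈ range M, T r := by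
  have h1 := integral_comp_mul_right_Ioi (fun u => T ⌊u⌋₊) 0 hs
  rw [zero_mul, smul_eq_mul] at h1
  rw [h1]
  congr 1
  have hc : ∀ r : ℕ, Set.EqOn (fun u : ℝ => T ⌊u⌋₊) (fun _ => T r) (Set.Ioo (r : ℝ) (r + 1)) := by
    intro r u hu
    simp only
    rw [(Nat.floor_eq_iff (by have := hu.1; have : (0 : ℝ) ≤ r := by positivity
                              linarith)).2 ⟨hu.1.le, hu.2⟩]
  have h2 : ∫ u in Set.Ioi (0 : ℝ), T ⌊u⌋₊ = ∫ u in Set.Ioc (0 : ℝ) M, T ⌊u⌋₊ := by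
    refine setIntegral_eq_of_subset_of_forall_sdiff_eq_zero measurableSet_Ioi
      Set.Ioc_subset_Ioi_self ?_
    intro u hu
    apply hT
    rw [Nat.le_floor_iff hu.1.le]
    by_contra hcon
    exact hu.2 ⟨hu.1, (not_le.1 hcon).le⟩
  rw [h2, ← intervalIntegral.integral_of_le (by positivity)]
  have h3 := intervalIntegral.sum_integral_adjacent_intervals (μ := volume) (a := fun k : ℕ => (k : ℝ)) (n := M)
    (f := fun u => T ⌊u⌋₊) ?_
  · rw [Nat.cast_zero] at h3
    rw [← h3]
    apply sum_congr rfl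
    intro r _
    rw [intervalIntegral.integral_of_le (by push_cast; linarith), integral_Ioc_eq_integral_Ioo]
    push_cast
    rw [setIntegral_congr_fun measurableSet_Ioo (hc r)]
    simp
  · intro k _
    rw [intervalIntegrable_iff_integrableOn_Ioo_of_le (by push_cast; linarith)]
    push_cast
    refine IntegrableOn.congr_fun ?_ (hc k).symm measurableSet_Ioo
    simp

lemma Tm_real (n j k r p1 p2 h N1 N2 : ℕ) (hr1 : r ≤ j) (hr2 : r ≤ k) (hr3 : j + k + 1 ≤ n + r)
    (hp1 : p1 = j - r) (hp2 : p2 = k - r) (hh : h = n + r - j - k) (hN1 : N1 = 2 * p1 + h)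
    (hN2 : N2 = 2 * p2 + h) :
    (Tm n j k r : ℝ) / 4 ^ n = (catalan r / 4 ^ r) * (h : ℝ) ^ 2 *
      ((N1 : ℝ) * N2) ^ (-(3 / 2) : ℝ) * (nb N1 p1 * nb N2 p2) := by
  rw [Tm, if_pos ⟨hr1, hr2, hr3⟩, ← hh, ← hp1, ← hp2]
  push_cast
  obtain ⟨s, hs⟩ : ∃ s, h = s + 1 := ⟨h - 1, by omega⟩
  have hp : (4 : ℝ) ^ n = 4 ^ r * (2 ^ N1 * 2 ^ N2) := by
    rw [← pow_add, show (4 : ℝ) = 2 ^ 2 by norm_num, ← pow_mul, ← pow_mul, ← pow_add]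
    congr 1
    omega
  rw [hs, bal_choose, bal_choose, ← hs, ← hN1, ← hN2, hp]
  have hN1p : (0 : ℝ) < N1 := by exact_mod_cast (by omega : 0 < N1)
  have hN2p : (0 : ℝ) < N2 := by exact_mod_cast (by omega : 0 < N2)
  have e : ((N1 : ℝ) * N2) ^ (-(3 / 2) : ℝ) = ((N1 : ℝ) * N2 * (√N1 * √N2))⁻¹ := by
    rw [rpow_neg (by positivity), show (3 / 2 : ℝ) = 1 + 1 / 2 by norm_num,
      rpow_add (by positivity), rpow_one, ← sqrt_eq_rpow, sqrt_mul hN1p.le]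
  rw [e, nb, nb]
  have := sqrt_pos.2 hN1p
  have := sqrt_pos.2 hN2p
  field_simp

lemma Tm_scaled (n j k r p1 p2 h N1 N2 : ℕ) (hn : 0 < n) (hr0 : 0 < r)
    (hr1 : r ≤ j) (hr2 : r ≤ k) (hr3 : j + k + 1 ≤ n + r)
    (hp1 : p1 = j - r) (hp2 : p2 = k - r) (hh : h = n + r - j - k) (hN1 : N1 = 2 * p1 + h)
    (hN2 : N2 = 2 * p2 + h) :
    (n : ℝ) ^ (11 / 4 : ℝ) * (Tm n j k r / 4 ^ n) =
      ((r : ℝ) ^ (3 / 2 : ℝ) * (catalan r : ℝ) / 4 ^ r) * ((r : ℝ) / √n) ^ (-(3 / 2) : ℝ) *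
      ((h : ℝ) / √n) ^ 2 * (((N1 : ℝ) / n) * (N2 / n)) ^ (-(3 / 2) : ℝ) * (nb N1 p1 * nb N2 p2) := by
  rw [Tm_real n j k r p1 p2 h N1 N2 hr1 hr2 hr3 hp1 hp2 hh hN1 hN2]
  have hN1p : (0 : ℝ) < N1 := by exact_mod_cast (by omega : 0 < N1)
  have hN2p : (0 : ℝ) < N2 := by exact_mod_cast (by omega : 0 < N2)
  have hn' : (0 : ℝ) < n := by exact_mod_cast hn
  have hr' : (0 : ℝ) < r := by exact_mod_cast hr0
  have e1 : ((r : ℝ) / √n) ^ (-(3 / 2) : ℝ) = (r : ℝ) ^ (-(3 / 2) : ℝ) * (n : ℝ) ^ (3 / 4 : ℝ) := by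
    rw [div_rpow hr'.le (by positivity), sqrt_eq_rpow, ← rpow_mul hn'.le, div_eq_mul_inv,
      ← rpow_neg hn'.le]
    norm_num
  have e2 : (((N1 : ℝ) / n) * (N2 / n)) ^ (-(3 / 2) : ℝ) =
      ((N1 : ℝ) * N2) ^ (-(3 / 2) : ℝ) * (n : ℝ) ^ (3 : ℝ) := by
    rw [div_mul_div_comm, div_rpow (by positivity) (by positivity), ← sq, ← rpow_natCast,
      ← rpow_mul hn'.le, div_eq_mul_inv, ← rpow_neg hn'.le]
    norm_num
  have e3 : ((h : ℝ) / √n) ^ 2 = (h : ℝ) ^ 2 * (n : ℝ) ^ (-1 : ℝ) := by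
    rw [div_pow, sq_sqrt hn'.le, rpow_neg_one]; rfl
  have e4 : (r : ℝ) ^ (3 / 2 : ℝ) * (r : ℝ) ^ (-(3 / 2) : ℝ) = 1 := by
    rw [← rpow_add hr']; simp
  have e5 : (n : ℝ) ^ (11 / 4 : ℝ) = (n : ℝ) ^ (3 / 4 : ℝ) * (n : ℝ) ^ (-1 : ℝ) * (n : ℝ) ^ (3 : ℝ) := by
    rw [← rpow_add hn', ← rpow_add hn']; norm_num
  rw [e1, e2, e3, e5]
  linear_combination (-((n : ℝ) ^ (3 / 4 : ℝ) * (n : ℝ) ^ (-1 : ℝ) * (n : ℝ) ^ (3 : ℝ) * (catalan r / 4 ^ r) * (h : ℝ) ^ 2 *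
      ((N1 : ℝ) * N2) ^ (-(3 / 2) : ℝ) * (nb N1 p1 * nb N2 p2))) * e4

lemma Tm_nonneg_scaled (n j k r : ℕ) : (0 : ℝ) ≤ Tm n j k r / 4 ^ n := by
  by_cases hc : r ≤ j ∧ r ≤ k ∧ j + k + 1 ≤ n + r
  · rw [Tm_real n j k r _ _ _ _ _ hc.1 hc.2.1 hc.2.2 rfl rfl rfl rfl rfl]
    have := nb_nonneg (2 * (j - r) + (n + r - j - k)) (j - r)
    have := nb_nonneg (2 * (k - r) + (n + r - j - k)) (k - r)
    positivity
  · rw [Tm, if_neg hc]; simp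

lemma dom_aux (h N n t : ℝ) (hN : 0 ≤ N) (h2 : t ^ 2 * n ≤ 2 * h ^ 2 + 2 * n) (hu : N + 1 ≤ 3 * n) :
    -h ^ 2 ≤ (1 + -(1 / 24) * t ^ 2) * (4 * (N + 1)) := by
  rcases le_total (1 + -(1 / 24) * t ^ 2) 0 with hs | hs
  · have := mul_le_mul_of_nonpos_left (show 4 * (N + 1) ≤ 12 * n by linarith) hs
    nlinarith
  · have h1 : 0 ≤ (1 + -(1 / 24) * t ^ 2) * (4 * (N + 1)) := mul_nonneg hs (by linarith)
    have := sq_nonneg h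
    linarith

set_option maxHeartbeats 1000000 in
lemma Tm_dom (n j k : ℕ) (ε K β t : ℝ) (hε : 0 < ε) (hn : 1 ≤ n) (hj : j ≤ n)
    (hjn : ε * n ≤ (n : ℝ) - j) (hkn : ε * n ≤ (n : ℝ) - k) (hβ1 : 1 / 4 ≤ β) (hβ2 : β < 3 / 8)
    (hd : |(n : ℝ) - j - k| ≤ K * (n : ℝ) ^ β) (hd2 : (|(n : ℝ) - j - k| + 1) ^ 2 ≤ n) (ht : 0 < t) :
    (n : ℝ) ^ (11 / 4 : ℝ) * (Tm n j k ⌊t * √n⌋₊ / 4 ^ n) ≤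
      exp (1 / 4) * exp (1 / 4) * (ε ^ 2) ^ (-(3 / 2) : ℝ) * exp 1 *
        ((2 * (1 + t) + 2 * K ^ 2 * t ^ (1 / 2 - 4 * β)) * exp (-(1 / 24) * t ^ 2)) := by
  have hn' : (0 : ℝ) < n := by exact_mod_cast hn
  have hn1 : (1 : ℝ) ≤ n := by exact_mod_cast hn
  have hsn1 : 1 ≤ √(n : ℝ) := by rw [one_le_sqrt]; exact hn1
  set r := ⌊t * √n⌋₊ with hr
  by_cases hc : r ≤ j ∧ r ≤ k ∧ j + k + 1 ≤ n + r
  swap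
  · rw [Tm, if_neg hc]
    simp only [Int.cast_zero, zero_div, mul_zero]
    positivity
  obtain ⟨hr1, hr2, hr3⟩ := hc
  obtain ⟨p1, hp1⟩ : ∃ p1, p1 = j - r := ⟨_, rfl⟩
  obtain ⟨p2, hp2⟩ : ∃ p1, p1 = k - r := ⟨_, rfl⟩
  obtain ⟨h, hh⟩ : ∃ p1, p1 = n + r - j - k := ⟨_, rfl⟩
  obtain ⟨N1, hN1⟩ : ∃ p, p = 2 * p1 + h := ⟨_, rfl⟩
  obtain ⟨N2, hN2⟩ : ∃ p, p = 2 * p2 + h := ⟨_, rfl⟩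
  rw [Tm_real n j k r p1 p2 h N1 N2 hr1 hr2 hr3 hp1 hp2 hh hN1 hN2]
  have hN1b : ε * n ≤ N1 := by
    refine hkn.trans ?_
    have : n ≤ N1 + k := by omega
    have : (n : ℝ) ≤ N1 + k := by exact_mod_cast this
    linarith
  have hN2b : ε * n ≤ N2 := by
    refine hjn.trans ?_
    have : n ≤ N2 + j := by omega
    have : (n : ℝ) ≤ N2 + j := by exact_mod_cast this
    linarith
  have hN1u : (N1 : ℝ) + 1 ≤ 3 * n := by
    have : N1 + 1 ≤ 3 * n := by omega
    exact_mod_cast this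
  set d := (n : ℝ) - j - k with hddef
  have hhd : (h : ℝ) = r + d := by
    have : h + j + k = n + r := by omega
    have : (h : ℝ) + j + k = n + r := by exact_mod_cast this
    rw [hddef]; linarith
  have hrt : t * √n ≤ (r : ℝ) + 1 := (Nat.lt_floor_add_one _).le
  have hrt2 : (r : ℝ) ≤ t * √n := Nat.floor_le (by positivity)
  have hr0 : (0 : ℝ) ≤ r := by positivity
  have A1 := catalan_le r
  have A2 : (h : ℝ) ^ 2 ≤ 2 * ((r : ℝ) + 1) ^ 2 + 2 * d ^ 2 := by
    rw [hhd]; nlinarith [sq_nonneg ((r : ℝ) - d)]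
  have A3 : ((N1 : ℝ) * N2) ^ (-(3 / 2) : ℝ) ≤ (ε ^ 2) ^ (-(3 / 2) : ℝ) * (n : ℝ) ^ (-3 : ℝ) := by
    have : (ε ^ 2) ^ (-(3 / 2) : ℝ) * (n : ℝ) ^ (-3 : ℝ) = ((ε * n) * (ε * n)) ^ (-(3 / 2) : ℝ) := by
      rw [show (ε * n) * (ε * n) = ε ^ 2 * (n : ℝ) ^ 2 by ring, mul_rpow (by positivity) (by positivity),
        ← rpow_natCast (n : ℝ) 2, ← rpow_mul hn'.le]
      norm_num
    rw [this]
    apply rpow_le_rpow_of_nonpos (by positivity) _ (by norm_num)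
    gcongr
  have A4 : nb N1 p1 ≤ exp (1 / 4) * (exp 1 * exp (-(1 / 24) * t ^ 2)) := by
    refine (nb_le N1 p1 h hN1).trans ?_
    rw [← exp_add 1]
    gcongr
    rw [div_le_iff₀ (by positivity)]
    have hsq : (t * √n) ^ 2 ≤ ((r : ℝ) + 1) ^ 2 := by gcongr
    rw [mul_pow, sq_sqrt hn'.le] at hsq
    have h1 : ((r : ℝ) + 1) ^ 2 ≤ 2 * (h : ℝ) ^ 2 + 2 * (|d| + 1) ^ 2 := by
      have : (r : ℝ) + 1 ≤ h + (|d| + 1) := by rw [hhd]; linarith [neg_abs_le d]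
      have h0 : (0 : ℝ) ≤ h := by positivity
      have := pow_le_pow_left₀ (by positivity) this 2
      nlinarith [sq_nonneg ((h : ℝ) - (|d| + 1))]
    have h2 : t ^ 2 * n ≤ 2 * (h : ℝ) ^ 2 + 2 * n := by linarith
    exact dom_aux (h : ℝ) N1 n t (by positivity) h2 hN1u
  have A5 : nb N2 p2 ≤ exp (1 / 4) := by
    refine (nb_le N2 p2 h hN2).trans ?_
    apply mul_le_of_le_one_right (by positivity)
    rw [exp_le_one_iff]
    apply div_nonpos_of_nonpos_of_nonneg
    · simp only [Left.neg_nonpos_iff]; positivity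
    · positivity
  have hB1 := nb_nonneg N1 p1
  have hB2 := nb_nonneg N2 p2
  have hK : 0 ≤ d ^ 2 := sq_nonneg d
  have main : (n : ℝ) ^ (-(1 / 4) : ℝ) * (((r : ℝ) + 1) ^ (-(3 / 2) : ℝ) *
      (2 * ((r : ℝ) + 1) ^ 2 + 2 * d ^ 2)) ≤ 2 * (1 + t) + 2 * K ^ 2 * t ^ (1 / 2 - 4 * β) := by
    have r1 : (0 : ℝ) < (r : ℝ) + 1 := by positivity
    have B1 : (n : ℝ) ^ (-(1 / 4) : ℝ) * (((r : ℝ) + 1) ^ (-(3 / 2) : ℝ) * ((r : ℝ) + 1) ^ 2) ≤ 1 + t := by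
      have : ((r : ℝ) + 1) ^ (-(3 / 2) : ℝ) * ((r : ℝ) + 1) ^ 2 = ((r : ℝ) + 1) ^ (1 / 2 : ℝ) := by
        rw [← rpow_natCast _ 2, ← rpow_add r1]; norm_num
      rw [this]
      have h1 : (r : ℝ) + 1 ≤ √n * (1 + t) := by nlinarith
      have h2 : ((r : ℝ) + 1) ^ (1 / 2 : ℝ) ≤ (n : ℝ) ^ (1 / 4 : ℝ) * (1 + t) := by
        calc ((r : ℝ) + 1) ^ (1 / 2 : ℝ) ≤ (√n * (1 + t)) ^ (1 / 2 : ℝ) := by gcongr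
          _ = (n : ℝ) ^ (1 / 4 : ℝ) * (1 + t) ^ (1 / 2 : ℝ) := by
              rw [mul_rpow (by positivity) (by positivity), sqrt_eq_rpow, ← rpow_mul hn'.le]
              norm_num
          _ ≤ (n : ℝ) ^ (1 / 4 : ℝ) * (1 + t) := by
              gcongr
              calc (1 + t) ^ (1 / 2 : ℝ) ≤ (1 + t) ^ (1 : ℝ) :=
                    rpow_le_rpow_of_exponent_le (by linarith) (by norm_num)
                _ = 1 + t := rpow_one _
      calc _ ≤ (n : ℝ) ^ (-(1 / 4) : ℝ) * ((n : ℝ) ^ (1 / 4 : ℝ) * (1 + t)) := by gcongr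
        _ = 1 + t := by rw [← mul_assoc, ← rpow_add hn']; simp
    have B2 : (n : ℝ) ^ (-(1 / 4) : ℝ) * (((r : ℝ) + 1) ^ (-(3 / 2) : ℝ) * d ^ 2) ≤
        K ^ 2 * t ^ (1 / 2 - 4 * β) := by
      have h1 : d ^ 2 ≤ K ^ 2 * (n : ℝ) ^ (2 * β) := by
        have := pow_le_pow_left₀ (abs_nonneg d) hd 2
        rw [sq_abs, mul_pow] at this
        rw [mul_comm 2 β, rpow_mul hn'.le]
        exact_mod_cast this
      have h2 : ((r : ℝ) + 1) ^ (-(3 / 2) : ℝ) ≤ (t * √n) ^ (1 / 2 - 4 * β) := by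
        calc ((r : ℝ) + 1) ^ (-(3 / 2) : ℝ) ≤ ((r : ℝ) + 1) ^ (1 / 2 - 4 * β) :=
              rpow_le_rpow_of_exponent_le (by linarith) (by linarith)
          _ ≤ _ := rpow_le_rpow_of_nonpos (by positivity) hrt (by linarith)
      calc _ ≤ (n : ℝ) ^ (-(1 / 4) : ℝ) * ((t * √n) ^ (1 / 2 - 4 * β) * (K ^ 2 * (n : ℝ) ^ (2 * β))) := by
            gcongr
        _ = K ^ 2 * t ^ (1 / 2 - 4 * β) * ((n : ℝ) ^ (-(1 / 4) : ℝ) * (n : ℝ) ^ (1 / 2 * (1 / 2 - 4 * β)) *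
              (n : ℝ) ^ (2 * β)) := by
            rw [mul_rpow ht.le (by positivity), sqrt_eq_rpow, ← rpow_mul hn'.le]; ring
        _ = _ := by
            rw [← rpow_add hn', ← rpow_add hn']
            ring_nf
            simp
    linarith
  have hcat : (0 : ℝ) ≤ (catalan r : ℝ) / 4 ^ r := by positivity
  calc (n : ℝ) ^ (11 / 4 : ℝ) * ((catalan r : ℝ) / 4 ^ r * (h : ℝ) ^ 2 * ((N1 : ℝ) * N2) ^ (-(3 / 2) : ℝ) *
        (nb N1 p1 * nb N2 p2))
      ≤ (n : ℝ) ^ (11 / 4 : ℝ) * (((r : ℝ) + 1) ^ (-(3 / 2) : ℝ) * (2 * ((r : ℝ) + 1) ^ 2 + 2 * d ^ 2) *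
        ((ε ^ 2) ^ (-(3 / 2) : ℝ) * (n : ℝ) ^ (-3 : ℝ)) *
        (exp (1 / 4) * (exp 1 * exp (-(1 / 24) * t ^ 2)) * exp (1 / 4))) := by gcongr
    _ = exp (1 / 4) * exp (1 / 4) * (ε ^ 2) ^ (-(3 / 2) : ℝ) * exp 1 * (((n : ℝ) ^ (11 / 4 : ℝ) * (n : ℝ) ^ (-3 : ℝ) *
          (((r : ℝ) + 1) ^ (-(3 / 2) : ℝ) * (2 * ((r : ℝ) + 1) ^ 2 + 2 * d ^ 2))) *
        exp (-(1 / 24) * t ^ 2)) := by ring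
    _ ≤ _ := by
        rw [← rpow_add hn']
        norm_num at main ⊢
        gcongr

lemma pw_aux (j k : ℕ → ℕ) (a b : ℝ) (ha0 : 0 < a)
    (hj : Tendsto (fun n : ℕ => (j n : ℝ) / n) atTop (nhds a))
    (hk : Tendsto (fun n : ℕ => (k n : ℝ) / n) atTop (nhds b)) (hab : a + b = 1)
    (r h : ℕ → ℕ) (t : ℝ)
    (hr : Tendsto (fun n : ℕ => (r n : ℝ) / √n) atTop (nhds t))
    (hh : Tendsto (fun n : ℕ => (h n : ℝ) / √n) atTop (nhds t))
    (hrj : ∀ᶠ n in atTop, r n ≤ j n)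
    (he : ∀ᶠ n in atTop, h n + j n + k n = n + r n) :
    Tendsto (fun n : ℕ => ((2 * (j n - r n) + h n : ℕ) : ℝ) / n) atTop (nhds (2 * a)) ∧
    Tendsto (fun n : ℕ => nb (2 * (j n - r n) + h n) (j n - r n)) atTop
      (nhds (√2 / √π * exp (-(t / √(2 * a)) ^ 2 / 2))) := by
  have hsn : Tendsto (fun n : ℕ => √(n : ℝ)) atTop atTop :=
    tendsto_sqrt_atTop.comp tendsto_natCast_atTop_atTop
  have hr0 : Tendsto (fun n : ℕ => (r n : ℝ) / n) atTop (nhds 0) := by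
    have := hr.mul hsn.inv_tendsto_atTop
    rw [mul_zero] at this
    refine this.congr' ?_
    filter_upwards [eventually_gt_atTop 0] with n hn
    have hn' : (0 : ℝ) < n := by exact_mod_cast hn
    simp only [Pi.inv_apply]
    rw [← div_eq_mul_inv, div_div, mul_self_sqrt hn'.le]
  have hN : Tendsto (fun n : ℕ => ((2 * (j n - r n) + h n : ℕ) : ℝ) / n) atTop (nhds (2 * a)) := by
    have := ((tendsto_const_nhds (x := (1 : ℝ))).add hj).sub (hk.add hr0)
    rw [show 1 + a - (b + 0) = 2 * a by linarith] at this
    refine this.congr' ?_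
    filter_upwards [eventually_gt_atTop 0, hrj, he] with n hn h1 h2
    have hn' : (0 : ℝ) < n := by exact_mod_cast hn
    have h2' : (h n : ℝ) + j n + k n = n + r n := by exact_mod_cast h2
    push_cast [Nat.cast_sub h1]
    field_simp
    linarith
  refine ⟨hN, ?_⟩
  apply nb_tendsto (fun n => j n - r n) h
  · rw [← tendsto_natCast_atTop_iff (R := ℝ)]
    have := (hj.sub hr0)
    rw [sub_zero] at this
    refine (this.pos_mul_atTop ha0 tendsto_natCast_atTop_atTop).congr' ?_
    filter_upwards [eventually_gt_atTop 0, hrj] with n hn h1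
    have hn' : (0 : ℝ) < n := by exact_mod_cast hn
    push_cast [Nat.cast_sub h1]
    field_simp
  · have := hh.div ((continuous_sqrt.tendsto _).comp hN) (by positivity)
    refine this.congr' ?_
    filter_upwards [eventually_gt_atTop 0] with n hn
    have hn' : (0 : ℝ) < n := by exact_mod_cast hn
    simp only [Pi.div_apply, Function.comp]
    rw [sqrt_div (by positivity)]
    have := sqrt_pos.2 hn'
    field_simp

lemma pw (j k : ℕ → ℕ) (a b : ℝ) (ha0 : 0 < a) (hb0 : 0 < b)
    (hj : Tendsto (fun n : ℕ => (j n : ℝ) / n) atTop (nhds a))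
    (hk : Tendsto (fun n : ℕ => (k n : ℝ) / n) atTop (nhds b)) (hab : a + b = 1)
    (hd : Tendsto (fun n : ℕ => ((n : ℝ) - j n - k n) / √n) atTop (nhds 0))
    (t : ℝ) (ht : 0 < t) :
    Tendsto (fun n : ℕ => (n : ℝ) ^ (11 / 4 : ℝ) * (Tm n (j n) (k n) ⌊t * √n⌋₊ / 4 ^ n)) atTop
      (nhds (1 / √π * t ^ (-(3 / 2) : ℝ) * t ^ 2 * ((2 * a) * (2 * b)) ^ (-(3 / 2) : ℝ) *
        ((√2 / √π * exp (-(t / √(2 * a)) ^ 2 / 2)) * (√2 / √π * exp (-(t / √(2 * b)) ^ 2 / 2))))) := by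
  have hsn : Tendsto (fun n : ℕ => √(n : ℝ)) atTop atTop :=
    tendsto_sqrt_atTop.comp tendsto_natCast_atTop_atTop
  obtain ⟨r, hrdef⟩ : ∃ r : ℕ → ℕ, r = fun n : ℕ => ⌊t * √(n : ℝ)⌋₊ := ⟨_, rfl⟩
  obtain ⟨h, hhdef⟩ : ∃ h : ℕ → ℕ, h = fun n : ℕ => n + r n - j n - k n := ⟨_, rfl⟩
  have hr : Tendsto (fun n : ℕ => (r n : ℝ) / √n) atTop (nhds t) := by
    rw [hrdef]
    exact (tendsto_nat_floor_mul_div_atTop ht.le).comp hsn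
  have hr0 : Tendsto (fun n : ℕ => (r n : ℝ) / n) atTop (nhds 0) := by
    have := hr.mul hsn.inv_tendsto_atTop
    rw [mul_zero] at this
    refine this.congr' ?_
    filter_upwards [eventually_gt_atTop 0] with n hn
    have hn' : (0 : ℝ) < n := by exact_mod_cast hn
    simp only [Pi.inv_apply]
    rw [← div_eq_mul_inv, div_div, mul_self_sqrt hn'.le]
  have hrj : ∀ᶠ n in atTop, r n ≤ j n := by
    have := hj.sub hr0
    rw [sub_zero] at this
    filter_upwards [eventually_gt_atTop 0, this.eventually (lt_mem_nhds ha0)] with n hn h1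
    have hn' : (0 : ℝ) < n := by exact_mod_cast hn
    rw [← sub_div, div_pos_iff_of_pos_right hn', sub_pos] at h1
    exact_mod_cast h1.le
  have hrk : ∀ᶠ n in atTop, r n ≤ k n := by
    have := hk.sub hr0
    rw [sub_zero] at this
    filter_upwards [eventually_gt_atTop 0, this.eventually (lt_mem_nhds hb0)] with n hn h1
    have hn' : (0 : ℝ) < n := by exact_mod_cast hn
    rw [← sub_div, div_pos_iff_of_pos_right hn', sub_pos] at h1
    exact_mod_cast h1.le
  have hdr := hd.add hr
  rw [zero_add] at hdr
  have h3 : ∀ᶠ n in atTop, j n + k n + 1 ≤ n + r n := by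
    filter_upwards [eventually_gt_atTop 0, hdr.eventually (lt_mem_nhds ht)] with n hn h1
    have hn' : (0 : ℝ) < √n := sqrt_pos.2 (by exact_mod_cast hn)
    rw [← add_div, div_pos_iff_of_pos_right hn'] at h1
    have : (j n + k n : ℝ) < n + r n := by linarith
    have : j n + k n < n + r n := by exact_mod_cast this
    omega
  have he : ∀ᶠ n in atTop, h n + j n + k n = n + r n := by
    filter_upwards [h3] with n h1
    rw [hhdef]; dsimp only; omega
  have hh : Tendsto (fun n : ℕ => (h n : ℝ) / √n) atTop (nhds t) := by
    refine hdr.congr' ?_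
    filter_upwards [he] with n h1
    have h2' : (h n : ℝ) + j n + k n = n + r n := by exact_mod_cast h1
    rw [← add_div]
    congr 1
    linarith
  have hrpos : ∀ᶠ n in atTop, 0 < r n := by
    filter_upwards [eventually_gt_atTop 0, hr.eventually (lt_mem_nhds ht)] with n hn h1
    have hn' : (0 : ℝ) < √n := sqrt_pos.2 (by exact_mod_cast hn)
    rw [div_pos_iff_of_pos_right hn'] at h1
    exact_mod_cast h1
  have hrtop : Tendsto r atTop atTop := by
    rw [← tendsto_natCast_atTop_iff (R := ℝ)]
    refine (hr.pos_mul_atTop ht hsn).congr' ?_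
    filter_upwards [eventually_gt_atTop 0] with n hn
    have hn' : (0 : ℝ) < √n := sqrt_pos.2 (by exact_mod_cast hn)
    field_simp
  obtain ⟨P1, P2⟩ := pw_aux j k a b ha0 hj hk hab r h t hr hh hrj he
  obtain ⟨P3, P4⟩ := pw_aux k j b a hb0 hk hj (by linarith) r h t hr hh hrk
    (he.mono fun n hn => by omega)
  have big := (((((catalan_tendsto.comp hrtop).mul (hr.rpow_const (p := (-(3 / 2) : ℝ))
    (Or.inl ht.ne'))).mul (hh.pow 2)).mul ((P1.mul P3).rpow_const (p := (-(3 / 2) : ℝ))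
    (Or.inl (by positivity)))).mul (P2.mul P4))
  refine big.congr' ?_
  filter_upwards [eventually_gt_atTop 0, hrpos, hrj, hrk, h3] with n hn q1 q2 q3 q4
  have := Tm_scaled n (j n) (k n) (r n) (j n - r n) (k n - r n) (h n) (2 * (j n - r n) + h n)
    (2 * (k n - r n) + h n) hn q1 q2 q3 q4 rfl rfl (by rw [hhdef]) rfl rfl
  rw [show ⌊t * √(n : ℝ)⌋₊ = r n by rw [hrdef], this]
  rfl

lemma pw_simp (a t : ℝ) (ha0 : 0 < a) (ha1 : a < 1) (ht : 0 < t) :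
    1 / √π * t ^ (-(3 / 2) : ℝ) * t ^ 2 * ((2 * a) * (2 * (1 - a))) ^ (-(3 / 2) : ℝ) *
        ((√2 / √π * exp (-(t / √(2 * a)) ^ 2 / 2)) * (√2 / √π * exp (-(t / √(2 * (1 - a))) ^ 2 / 2)))
    = (2 / (π * √π) * (4 * (a * (1 - a))) ^ (-(3 / 2) : ℝ)) *
      (t ^ (1 / 2 : ℝ) * exp (-(1 / (4 * (a * (1 - a)))) * t ^ (2 : ℝ))) := by
  have hb : 0 < 1 - a := by linarith
  have e1 : t ^ (1 / 2 : ℝ) = t ^ (-(3 / 2) : ℝ) * t ^ 2 := by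
    rw [← rpow_natCast t 2, ← rpow_add ht]; norm_num
  have e2 : exp (-(1 / (4 * (a * (1 - a)))) * t ^ (2 : ℝ)) =
      exp (-(t / √(2 * a)) ^ 2 / 2) * exp (-(t / √(2 * (1 - a))) ^ 2 / 2) := by
    rw [← exp_add, div_pow, div_pow, sq_sqrt (by positivity), sq_sqrt (by positivity), rpow_two]
    congr 1
    field_simp
    ring
  have e3 : √2 * √2 = (2 : ℝ) := mul_self_sqrt (by norm_num)
  have e4 : √π * √π = π := mul_self_sqrt pi_pos.le
  have e5 : (2 * a) * (2 * (1 - a)) = 4 * (a * (1 - a)) := by ring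
  have e6 : 2 / (π * √π) = 1 / √π * (√2 / √π * (√2 / √π)) := by
    rw [div_mul_div_comm, e3, e4]
    have := sqrt_pos.2 pi_pos
    field_simp
  rw [e1, e2, e5, e6]
  ring

lemma const_eq (A : ℝ) (hA : 0 < A) :
    (2 / (π * √π) * (4 * A) ^ (-(3 / 2) : ℝ)) *
      ((1 / (4 * A)) ^ (-(1 / 2 + 1) / 2 : ℝ) * (1 / 2) * Gamma ((1 / 2 + 1) / 2)) / (1 / √π) =
    Gamma (3 / 4) / (2 ^ (3 / 2 : ℝ) * π * A ^ (3 / 4 : ℝ)) := by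
  have e1 : (1 / (4 * A)) ^ (-(1 / 2 + 1) / 2 : ℝ) = (4 * A) ^ (3 / 4 : ℝ) := by
    rw [one_div, inv_rpow (by positivity), ← rpow_neg (by positivity)]
    norm_num
  have e2 : (4 * A) ^ (-(3 / 2) : ℝ) * (4 * A) ^ (3 / 4 : ℝ) = ((4 * A) ^ (3 / 4 : ℝ))⁻¹ := by
    rw [← rpow_add (by positivity), ← rpow_neg (by positivity)]; norm_num
  have e3 : (4 * A) ^ (3 / 4 : ℝ) = 2 ^ (3 / 2 : ℝ) * A ^ (3 / 4 : ℝ) := by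
    rw [mul_rpow (by norm_num) hA.le, show (4 : ℝ) = 2 ^ (2 : ℝ) by norm_num,
      ← rpow_mul (by norm_num)]
    norm_num
  rw [e1, show ((1 / 2 + 1) / 2 : ℝ) = 3 / 4 by norm_num]
  have hpi := sqrt_pos.2 pi_pos
  calc _ = ((4 * A) ^ (-(3 / 2) : ℝ) * (4 * A) ^ (3 / 4 : ℝ)) * (Gamma (3 / 4) / π) := by
        field_simp
    _ = _ := by
        rw [e2, e3]
        have : (0 : ℝ) < 2 ^ (3 / 2 : ℝ) := by positivity
        have : (0 : ℝ) < A ^ (3 / 4 : ℝ) := by positivity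
        field_simp

lemma dom_integrable (C K β : ℝ) (hβ2 : β < 3 / 8) :
    MeasureTheory.Integrable (fun t : ℝ => C * ((2 * (1 + t) + 2 * K ^ 2 * t ^ (1 / 2 - 4 * β)) *
      exp (-(1 / 24) * t ^ 2))) (MeasureTheory.volume.restrict (Set.Ioi 0)) := by
  have hb : (0 : ℝ) < 1 / 24 := by norm_num
  have i0 : MeasureTheory.Integrable _ (MeasureTheory.volume.restrict (Set.Ioi (0 : ℝ))) :=
    integrableOn_rpow_mul_exp_neg_mul_sq hb (s := 0) (by norm_num)
  have i1 : MeasureTheory.Integrable _ (MeasureTheory.volume.restrict (Set.Ioi (0 : ℝ))) :=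
    integrableOn_rpow_mul_exp_neg_mul_sq hb (s := 1) (by norm_num)
  have i2 : MeasureTheory.Integrable _ (MeasureTheory.volume.restrict (Set.Ioi (0 : ℝ))) :=
    integrableOn_rpow_mul_exp_neg_mul_sq hb (s := 1 / 2 - 4 * β) (by linarith)
  refine (((i0.const_mul 2).add ((i1.const_mul 2).add (i2.const_mul (2 * K ^ 2)))).const_mul C).congr ?_
  refine Filter.Eventually.of_forall fun t => ?_
  simp only [Pi.add_apply, rpow_zero, rpow_one]
  ring

lemma main_seq (j k : ℕ → ℕ) (a K β : ℝ) (ha0 : 0 < a) (ha1 : a < 1) (hβ1 : 1 / 4 ≤ β) (hβ2 : β < 3 / 8)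
    (hj : Tendsto (fun n : ℕ => (j n : ℝ) / n) atTop (nhds a))
    (hk : Tendsto (fun n : ℕ => (k n : ℝ) / n) atTop (nhds (1 - a)))
    (hd : ∀ᶠ n : ℕ in atTop, |(n : ℝ) - j n - k n| ≤ K * (n : ℝ) ^ β) :
    Tendsto (fun n : ℕ => (n : ℝ) ^ ((3 : ℝ) / 4) * (QcountZ n ((j n : ℤ) + 1) ((k n : ℤ) + 1) : ℝ) /
        (catalan n : ℝ)) atTop
      (nhds (Real.Gamma (3 / 4) /
        (2 ^ ((3 : ℝ) / 2) * π * (a * (1 - a)) ^ ((3 : ℝ) / 4)))) := by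
  have hb0 : 0 < 1 - a := by linarith
  have hA : 0 < a * (1 - a) := mul_pos ha0 hb0
  have hsn : Tendsto (fun n : ℕ => √(n : ℝ)) atTop atTop :=
    tendsto_sqrt_atTop.comp tendsto_natCast_atTop_atTop
  have hdabs : Tendsto (fun n : ℕ => |(n : ℝ) - j n - k n| / √n) atTop (nhds 0) := by
    have h0 : Tendsto (fun n : ℕ => K * (n : ℝ) ^ (-(1 / 2 - β))) atTop (nhds 0) := by
      have := ((tendsto_rpow_neg_atTop (y := 1 / 2 - β) (by linarith)).comp
        (tendsto_natCast_atTop_atTop (R := ℝ))).const_mul K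
      rw [mul_zero] at this
      exact this
    refine squeeze_zero' (Eventually.of_forall fun n => by positivity) ?_ h0
    filter_upwards [hd, eventually_gt_atTop 0] with n h1 hn
    have hn' : (0 : ℝ) < n := by exact_mod_cast hn
    rw [div_le_iff₀ (sqrt_pos.2 hn'), sqrt_eq_rpow, mul_assoc, ← rpow_add hn']
    refine h1.trans (le_of_eq ?_)
    congr 2
    ring
  have hd0 : Tendsto (fun n : ℕ => ((n : ℝ) - j n - k n) / √n) atTop (nhds 0) := by
    rw [tendsto_zero_iff_abs_tendsto_zero]
    refine hdabs.congr fun n => ?_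
    simp only [Function.comp, abs_div, abs_of_nonneg (sqrt_nonneg _)]
  have hd2 : ∀ᶠ n : ℕ in atTop, (|(n : ℝ) - j n - k n| + 1) ^ 2 ≤ n := by
    have := hdabs.add hsn.inv_tendsto_atTop
    rw [add_zero] at this
    filter_upwards [this.eventually (gt_mem_nhds one_pos), eventually_gt_atTop 0] with n h1 hn
    have hn' : (0 : ℝ) < n := by exact_mod_cast hn
    have hs := sqrt_pos.2 hn'
    simp only [Pi.inv_apply] at h1
    rw [← one_div, ← add_div, div_lt_one hs] at h1
    have := pow_le_pow_left₀ (by positivity) h1.le 2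
    rwa [sq_sqrt hn'.le] at this
  obtain ⟨ε, hε, hεa, hεb⟩ : ∃ ε : ℝ, 0 < ε ∧ ε < a ∧ ε < 1 - a :=
    ⟨min a (1 - a) / 2, by positivity, by
      have := min_le_left a (1 - a); linarith, by
      have := min_le_right a (1 - a); linarith⟩
  have hjn : ∀ᶠ n : ℕ in atTop, ε * n ≤ (n : ℝ) - j n := by
    filter_upwards [hj.eventually (gt_mem_nhds (show a < 1 - ε by linarith)),
      eventually_gt_atTop 0] with n h1 hn
    have hn' : (0 : ℝ) < n := by exact_mod_cast hn
    rw [div_lt_iff₀ hn'] at h1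
    linarith
  have hkn : ∀ᶠ n : ℕ in atTop, ε * n ≤ (n : ℝ) - k n := by
    filter_upwards [hk.eventually (gt_mem_nhds (show 1 - a < 1 - ε by linarith)),
      eventually_gt_atTop 0] with n h1 hn
    have hn' : (0 : ℝ) < n := by exact_mod_cast hn
    rw [div_lt_iff₀ hn'] at h1
    linarith
  have hjlt : ∀ᶠ n : ℕ in atTop, j n < n := by
    filter_upwards [hjn, eventually_gt_atTop 0] with n h1 hn
    have hn' : (0 : ℝ) < n := by exact_mod_cast hn
    have : (j n : ℝ) < n := by nlinarith
    exact_mod_cast this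
  have conv := MeasureTheory.tendsto_integral_filter_of_dominated_convergence
    (μ := MeasureTheory.volume.restrict (Set.Ioi (0 : ℝ))) (l := atTop)
    (F := fun (n : ℕ) (t : ℝ) => (n : ℝ) ^ (11 / 4 : ℝ) * (Tm n (j n) (k n) ⌊t * √n⌋₊ / 4 ^ n))
    (f := fun t => (2 / (π * √π) * (4 * (a * (1 - a))) ^ (-(3 / 2) : ℝ)) *
      (t ^ (1 / 2 : ℝ) * exp (-(1 / (4 * (a * (1 - a)))) * t ^ (2 : ℝ))))
    (fun t => exp (1 / 4) * exp (1 / 4) * (ε ^ 2) ^ (-(3 / 2) : ℝ) * exp 1 *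
        ((2 * (1 + t) + 2 * K ^ 2 * t ^ (1 / 2 - 4 * β)) * exp (-(1 / 24) * t ^ 2)))
    (Eventually.of_forall fun n => by
      apply Measurable.aestronglyMeasurable
      have hm : Measurable (fun m : ℕ => (n : ℝ) ^ (11 / 4 : ℝ) * ((Tm n (j n) (k n) m : ℝ) / 4 ^ n)) :=
        measurable_from_top
      exact hm.comp (Nat.measurable_floor.comp (measurable_id.mul_const _)))
    (by
      filter_upwards [hjn, hkn, hd, hd2, hjlt, eventually_ge_atTop 1] with n q1 q2 q3 q4 q5 q6
      refine (MeasureTheory.ae_restrict_iff' measurableSet_Ioi).2 (Eventually.of_forall fun t ht => ?_)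
      have h0 := Tm_nonneg_scaled n (j n) (k n) ⌊t * √(n : ℝ)⌋₊
      rw [norm_of_nonneg (by positivity)]
      exact Tm_dom n (j n) (k n) ε K β t hε q6 q5.le q1 q2 hβ1 hβ2 q3 q4 ht)
    (dom_integrable _ K β hβ2)
    ((MeasureTheory.ae_restrict_iff' measurableSet_Ioi).2 (Eventually.of_forall fun t ht => by
      rw [← pw_simp a t ha0 ha1 ht]
      exact pw j k a (1 - a) ha0 hb0 hj hk (by ring) hd0 t ht))
  rw [MeasureTheory.integral_const_mul, integral_rpow_mul_exp_neg_mul_rpow (by norm_num) (by norm_num)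
    (by positivity)] at conv
  have fin := conv.div catalan_tendsto (by positivity)
  rw [const_eq _ hA] at fin
  refine fin.congr' ?_
  filter_upwards [hjlt, eventually_gt_atTop 0] with n q1 hn
  have hn' : (0 : ℝ) < n := by exact_mod_cast hn
  have hs := sum_eq_integral (fun r => (n : ℝ) ^ (11 / 4 : ℝ) * ((Tm n (j n) (k n) r : ℝ) / 4 ^ n)) n
    (fun r hr => by
      simp only [Tm]
      rw [if_neg (by omega)]
      simp) (√n) (sqrt_pos.2 hn')
  have hQ : (QcountZ n ((j n : ℤ) + 1) ((k n : ℤ) + 1) : ℝ) =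
      ∑ r ∈ range n, (Tm n (j n) (k n) r : ℝ) := by
    have := QcountZ_formula n (j n) (k n)
    exact_mod_cast this
  simp only [Pi.div_apply]
  rw [hs, ← Finset.mul_sum, ← Finset.sum_div, ← hQ]
  have e1 : (n : ℝ) ^ (11 / 4 : ℝ) = (n : ℝ) ^ (3 / 4 : ℝ) * (n : ℝ) ^ (3 / 2 : ℝ) * √n := by
    rw [sqrt_eq_rpow, ← rpow_add hn', ← rpow_add hn']; norm_num
  rw [e1]
  have := sqrt_pos.2 hn'
  have : (0 : ℝ) < (n : ℝ) ^ (3 / 2 : ℝ) := by positivity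
  have : (0 : ℝ) < catalan n := by
    have h := succ_mul_catalan_eq_centralBinom n
    have h2 := Nat.centralBinom_pos n
    have : 0 < catalan n := by
      by_contra h3
      have : catalan n = 0 := by omega
      rw [this] at h; omega
    exact_mod_cast this
  field_simp

lemma floor_aux (a c α : ℝ) (ha : 0 < a) (hα : α < 1) :
    Tendsto (fun n : ℕ => (((⌊a * n - c * (n : ℝ) ^ α⌋ - 1).toNat : ℕ) : ℝ) / n) atTop (nhds a) ∧
    ∀ᶠ n : ℕ in atTop, (((⌊a * n - c * (n : ℝ) ^ α⌋ - 1).toNat : ℕ) : ℤ) + 1 =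
      ⌊a * n - c * (n : ℝ) ^ α⌋ := by
  have h0 : Tendsto (fun n : ℕ => c * (n : ℝ) ^ (-(1 - α))) atTop (nhds 0) := by
    have := ((tendsto_rpow_neg_atTop (y := 1 - α) (by linarith)).comp
      (tendsto_natCast_atTop_atTop (R := ℝ))).const_mul c
    rw [mul_zero] at this
    exact this
  have hx : Tendsto (fun n : ℕ => (a * n - c * (n : ℝ) ^ α) / n) atTop (nhds a) := by
    have := (tendsto_const_nhds (x := a)).sub h0
    rw [sub_zero] at this
    refine this.congr' ?_
    filter_upwards [eventually_gt_atTop 0] with n hn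
    have hn' : (0 : ℝ) < n := by exact_mod_cast hn
    rw [sub_div, mul_div_cancel_right₀ _ hn'.ne', mul_div_assoc]
    congr 2
    rw [eq_div_iff hn'.ne']
    nth_rewrite 2 [← rpow_one (n : ℝ)]
    rw [← rpow_add hn']
    congr 1
    ring
  have htop : Tendsto (fun n : ℕ => a * n - c * (n : ℝ) ^ α) atTop atTop := by
    refine (hx.pos_mul_atTop ha (tendsto_natCast_atTop_atTop (R := ℝ))).congr' ?_
    filter_upwards [eventually_gt_atTop 0] with n hn
    have hn' : (0 : ℝ) < n := by exact_mod_cast hn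
    field_simp
  have hev : ∀ᶠ n : ℕ in atTop, (((⌊a * n - c * (n : ℝ) ^ α⌋ - 1).toNat : ℕ) : ℤ) + 1 =
      ⌊a * n - c * (n : ℝ) ^ α⌋ := by
    filter_upwards [htop.eventually_ge_atTop 1] with n hn
    have : (1 : ℤ) ≤ ⌊a * n - c * (n : ℝ) ^ α⌋ := by rw [Int.le_floor]; exact_mod_cast hn
    omega
  refine ⟨?_, hev⟩
  have hinv : Tendsto (fun n : ℕ => 2 / (n : ℝ)) atTop (nhds 0) :=
    tendsto_const_div_atTop_nhds_zero_nat 2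
  have hlow := hx.sub hinv
  rw [sub_zero] at hlow
  refine tendsto_of_tendsto_of_tendsto_of_le_of_le' hlow hx ?_ ?_
  · filter_upwards [hev, eventually_gt_atTop 0] with n h1 hn
    have h1' : (((⌊a * n - c * (n : ℝ) ^ α⌋ - 1).toNat : ℕ) : ℝ) + 1 =
      ⌊a * n - c * (n : ℝ) ^ α⌋ := by exact_mod_cast h1
    have := Int.lt_floor_add_one (a * n - c * (n : ℝ) ^ α)
    rw [← sub_div]
    gcongr
    linarith
  · filter_upwards [hev, eventually_gt_atTop 0] with n h1 hn
    have h1' : (((⌊a * n - c * (n : ℝ) ^ α⌋ - 1).toNat : ℕ) : ℝ) + 1 =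
      ⌊a * n - c * (n : ℝ) ^ α⌋ := by exact_mod_cast h1
    have := Int.floor_le (a * n - c * (n : ℝ) ^ α)
    gcongr
    linarith

/-- For `0 ≤ α < 3/8`,
`n^{3/4} Q_n(⌊an - cn^α⌋, ⌊(1-a)n - cn^α⌋)/C_n → Γ(3/4)/(2^{3/2} π (a(1-a))^{3/4})`. -/
theorem Qcount_antidiagonal_limit (a : ℝ) (ha0 : 0 < a) (ha1 : a < 1)
    (c : ℝ) (α : ℝ) (hα0 : 0 ≤ α) (hα1 : α < 3 / 8) :
    Tendsto (fun n : ℕ =>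
        (n : ℝ) ^ ((3 : ℝ) / 4) *
          (QcountZ n ⌊a * n - c * (n : ℝ) ^ α⌋ ⌊(1 - a) * n - c * (n : ℝ) ^ α⌋ : ℝ) /
          (catalan n : ℝ))
      atTop
      (nhds (Real.Gamma (3 / 4) /
        (2 ^ ((3 : ℝ) / 2) * π * (a * (1 - a)) ^ ((3 : ℝ) / 4)))) := by
  obtain ⟨J1, J2⟩ := floor_aux a c α ha0 (by linarith)
  obtain ⟨K1, K2⟩ := floor_aux (1 - a) c α (by linarith) (by linarith)
  have key := main_seq (fun n : ℕ => (⌊a * n - c * (n : ℝ) ^ α⌋ - 1).toNat)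
    (fun n : ℕ => (⌊(1 - a) * n - c * (n : ℝ) ^ α⌋ - 1).toNat) a (2 * |c| + 4) (max α (1 / 4))
    ha0 ha1 (le_max_right _ _) (max_lt hα1 (by norm_num)) J1 K1 (by
      filter_upwards [J2, K2, eventually_ge_atTop 1] with n h1 h2 hn
      have hn' : (1 : ℝ) ≤ n := by exact_mod_cast hn
      have h1' : (((⌊a * n - c * (n : ℝ) ^ α⌋ - 1).toNat : ℕ) : ℝ) + 1 =
        ⌊a * n - c * (n : ℝ) ^ α⌋ := by exact_mod_cast h1
      have h2' : (((⌊(1 - a) * n - c * (n : ℝ) ^ α⌋ - 1).toNat : ℕ) : ℝ) + 1 =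
        ⌊(1 - a) * n - c * (n : ℝ) ^ α⌋ := by exact_mod_cast h2
      have f1 := Int.lt_floor_add_one (a * n - c * (n : ℝ) ^ α)
      have f2 := Int.floor_le (a * n - c * (n : ℝ) ^ α)
      have f3 := Int.lt_floor_add_one ((1 - a) * n - c * (n : ℝ) ^ α)
      have f4 := Int.floor_le ((1 - a) * n - c * (n : ℝ) ^ α)
      have g1 : (n : ℝ) ^ α ≤ (n : ℝ) ^ (max α (1 / 4)) :=
        rpow_le_rpow_of_exponent_le hn' (le_max_left _ _)
      have g2 : (1 : ℝ) ≤ (n : ℝ) ^ (max α (1 / 4)) :=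
        one_le_rpow hn' (by positivity)
      have g3 : |c * (n : ℝ) ^ α| ≤ |c| * (n : ℝ) ^ (max α (1 / 4)) := by
        rw [abs_mul, abs_of_nonneg (show (0 : ℝ) ≤ (n : ℝ) ^ α by positivity)]
        gcongr
      have g4 := abs_le.1 g3
      rw [abs_le]
      constructor <;> linarith [g4.1, g4.2])
  refine key.congr' ?_
  filter_upwards [J2, K2] with n h1 h2
  rw [h1, h2]
end

section
/- For all n ≥ 1 and all 1 ≤ j ≤ n, one has Q_n(j, n) = C_{j−1} · C_{n−j}; consequently Q_n(j, n) = Q_n(n+1−j, n) for all 1 ≤ j ≤ n. -/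
open Filter Finset Real

/-- `P_n(j,k)`: the number of 123-avoiding permutations of `{1,…,n}` with value `k`
in position `j` (1-indexed). -/
noncomputable def Pcount (n j k : ℕ) : ℕ :=
  Nat.card {σ : Equiv.Perm (Fin n) //
    Avoids σ pattern123 ∧ ∃ i : Fin n, (i : ℕ) + 1 = j ∧ (σ i : ℕ) + 1 = k}

/-- `Q_n(j,k)`: the number of 132-avoiding permutations of `{1,…,n}` with value `k`
in position `j` (1-indexed). -/
noncomputable def Qcount (n j k : ℕ) : ℕ :=
  Nat.card {σ : Equiv.Perm (Fin n) //
    Avoids σ pattern132 ∧ ∃ i : Fin n, (i : ℕ) + 1 = j ∧ (σ i : ℕ) + 1 = k}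

/-- Being (the extension by zero of) a 132-avoiding permutation of `{0,…,n-1}`. -/
def AvFun (n : ℕ) (f : ℕ → ℕ) : Prop :=
  (∀ i, i < n → f i < n) ∧ (∀ i, n ≤ i → f i = 0) ∧
  (∀ i j, i < n → j < n → f i = f j → i = j) ∧
  ∀ i j k, i < j → j < k → k < n → f i < f k → f k < f j → False

lemma AvFun.finite (n : ℕ) : Finite {f // AvFun n f} := by
  refine Finite.of_injective
    (fun (f : {f // AvFun n f}) (i : Fin n) => (⟨f.1 i, f.2.1 i i.2⟩ : Fin n)) ?_
  rintro ⟨f, hf⟩ ⟨g, hg⟩ h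
  ext i
  by_cases hi : i < n
  · have := congrFun h ⟨i, hi⟩
    simpa using this
  · simp [hf.2.1 i (by omega), hg.2.1 i (by omega)]

lemma AvFun.lower {a b : ℕ} {f : ℕ → ℕ} (hf : AvFun (a + b + 1) f) (ha : f a = a + b)
    (i : ℕ) (hi : i < a) : b ≤ f i := by
  obtain ⟨h1, h2, h3, h4⟩ := hf
  have := Finset.card_le_card_of_injOn (s := Finset.Ioo a (a + b + 1)) (t := Finset.range (f i)) f
    (by
      intro k hk
      simp at hk ⊢
      have hk2 : k < a + b + 1 := by omega
      have q1 := h1 k hk2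
      have q2 := h3 k a hk2 (by omega)
      have q3 := h3 k i hk2 (by omega)
      by_contra hlt
      exact h4 i a k hi hk.1 hk2 (by omega) (by omega))
    (by
      intro x hx y hy hxy
      simp at hx hy
      exact h3 x y (by omega) (by omega) hxy)
  simp at this
  omega

lemma AvFun.upper {a b : ℕ} {f : ℕ → ℕ} (hf : AvFun (a + b + 1) f) (ha : f a = a + b)
    (k : ℕ) (hk : a < k) (hk' : k < a + b + 1) : f k < b := by
  obtain ⟨h1, h2, h3, h4⟩ := hf
  have := Finset.card_le_card_of_injOn (s := Finset.range (a + 1))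
    (t := Finset.Ioo (f k) (a + b + 1)) f
    (by
      intro i hi
      simp at hi ⊢
      have := h1 k hk'
      have := h1 i (by omega)
      have := h3 k a hk' (by omega)
      have := h3 k i hk' (by omega)
      by_cases hia : i = a
      · subst hia
        omega
      by_contra hlt
      exact h4 i a k (by omega) hk hk' (by omega) (by omega))
    (by
      intro x hx y hy hxy
      simp at hx hy
      exact h3 x y (by omega) (by omega) hxy)
  simp at this
  have := h1 k hk'
  omega

lemma AvFun.exists_max {n : ℕ} {f : ℕ → ℕ} (hf : AvFun (n + 1) f) :
    ∃ a, a < n + 1 ∧ f a = n := by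
  by_contra! hne
  obtain ⟨h1, h2, h3, h4⟩ := hf
  have := Finset.card_le_card_of_injOn (s := Finset.range (n + 1)) (t := Finset.range n) f
    (by
      intro i hi
      simp at hi ⊢
      have := h1 i (by omega)
      have := hne i (by omega)
      omega)
    (by
      intro x hx y hy hxy
      simp at hx hy
      exact h3 x y (by omega) (by omega) hxy)
  simp at this

/-- Left part. -/
def leftPart (a b : ℕ) (f : ℕ → ℕ) (i : ℕ) : ℕ := if i < a then f i - b else 0

/-- Right part. -/
def rightPart (a b : ℕ) (f : ℕ → ℕ) (i : ℕ) : ℕ := if i < b then f (a + 1 + i) else 0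

/-- Gluing. -/
def glue (a b : ℕ) (g h : ℕ → ℕ) (i : ℕ) : ℕ :=
  if i < a then g i + b else if i = a then a + b else if i < a + b + 1 then h (i - (a + 1)) else 0

lemma left_av {a b : ℕ} {f : ℕ → ℕ} (hf : AvFun (a + b + 1) f) (ha : f a = a + b) :
    AvFun a (leftPart a b f) := by
  have hl := hf.lower ha
  obtain ⟨h1, h2, h3, h4⟩ := hf
  have h5 : ∀ i, i < a → f i < a + b := by
    intro i hi
    have := h1 i (by omega)
    have := h3 i a (by omega) (by omega)
    omega
  refine ⟨?_, ?_, ?_, ?_⟩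
  · intro i hi
    have := hl i hi
    have := h5 i hi
    simp [leftPart, hi]; omega
  · intro i hi
    simp [leftPart]; omega
  · intro i j hi hj hij
    simp [leftPart, hi, hj] at hij
    have := hl i hi
    have := hl j hj
    exact h3 i j (by omega) (by omega) (by omega)
  · intro i j k hij hjk hk
    have hj : j < a := by omega
    have hi : i < a := by omega
    simp only [leftPart, hi, hj, hk, if_true]
    have := hl i hi
    have := hl j hj
    have := hl k hk
    intro u v
    exact h4 i j k hij hjk (by omega) (by omega) (by omega)

lemma right_av {a b : ℕ} {f : ℕ → ℕ} (hf : AvFun (a + b + 1) f) (ha : f a = a + b) :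
    AvFun b (rightPart a b f) := by
  have hl := hf.upper ha
  obtain ⟨h1, h2, h3, h4⟩ := hf
  refine ⟨?_, ?_, ?_, ?_⟩
  · intro i hi
    simp only [rightPart, hi, if_true]
    exact hl _ (by omega) (by omega)
  · intro i hi
    simp [rightPart]; omega
  · intro i j hi hj hij
    simp [rightPart, hi, hj] at hij
    have := h3 _ _ (by omega) (by omega) hij
    omega
  · intro i j k hij hjk hk
    have hj : j < b := by omega
    have hi : i < b := by omega
    simp only [rightPart, hi, hj, hk, if_true]
    exact h4 _ _ _ (by omega) (by omega) (by omega)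

lemma glue_av {a b : ℕ} {g h : ℕ → ℕ} (hg : AvFun a g) (hh : AvFun b h) :
    AvFun (a + b + 1) (glue a b g h) := by
  obtain ⟨g1, g2, g3, g4⟩ := hg
  obtain ⟨h1, h2, h3, h4⟩ := hh
  have e1 : ∀ i, i < a → glue a b g h i = g i + b := by
    intro i hi; simp [glue, hi]
  have e2 : glue a b g h a = a + b := by simp [glue]
  have e3 : ∀ i, a < i → i < a + b + 1 → glue a b g h i = h (i - (a + 1)) := by
    intro i hi hi'
    simp [glue, hi', show ¬ i < a by omega, show i ≠ a by omega]
  have e4 : ∀ i, a + b + 1 ≤ i → glue a b g h i = 0 := by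
    intro i hi
    simp [glue, show ¬ i < a by omega, show i ≠ a by omega, show ¬ i < a + b + 1 by omega]
  have b1 : ∀ i, i < a → b ≤ glue a b g h i ∧ glue a b g h i < a + b := by
    intro i hi
    have := g1 i hi
    rw [e1 i hi]; omega
  have b3 : ∀ i, a < i → i < a + b + 1 → glue a b g h i < b := by
    intro i hi hi'
    rw [e3 i hi hi']
    exact h1 _ (by omega)
  refine ⟨?_, e4, ?_, ?_⟩
  · intro i hi
    rcases lt_trichotomy i a with h | h | h
    · have := b1 i h; omega
    · subst h; omega
    · have := b3 i h hi; omega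
  · intro i j hi hj hij
    rcases lt_trichotomy i a with p | p | p <;> rcases lt_trichotomy j a with q | q | q
    · rw [e1 i p, e1 j q] at hij
      exact g3 i j p q (by omega)
    · subst q; have := b1 i p; omega
    · have := b1 i p; have := b3 j q hj; omega
    · subst p; have := b1 j q; omega
    · omega
    · subst p; have := b3 j q hj; omega
    · have := b3 i p hi; have := b1 j q; omega
    · subst q; have := b3 i p hi; omega
    · rw [e3 i p hi, e3 j q hj] at hij
      have := h3 _ _ (by omega) (by omega) hij
      omega
  · intro i j k hij hjk hk hik hkj
    rcases lt_trichotomy k a with r | r | r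
    · rw [e1 i (by omega), e1 k r] at hik
      rw [e1 j (by omega), e1 k r] at hkj
      exact g4 i j k hij hjk r (by omega) (by omega)
    · subst r
      have := b1 j hjk
      omega
    · have := b3 k r hk
      rcases lt_trichotomy i a with p | p | p
      · have := b1 i p; omega
      · subst p; omega
      · rw [e3 i p (by omega), e3 k r hk] at hik
        rw [e3 j (by omega) (by omega), e3 k r hk] at hkj
        exact h4 _ _ _ (by omega) (by omega) (by omega) hik hkj

lemma glue_left {a b : ℕ} {g h : ℕ → ℕ} (hg : AvFun a g) :
    leftPart a b (glue a b g h) = g := by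
  ext i
  by_cases hi : i < a
  · simp [leftPart, glue, hi]
  · simp [leftPart, hi, hg.2.1 i (by omega)]

lemma glue_right {a b : ℕ} {g h : ℕ → ℕ} (hh : AvFun b h) :
    rightPart a b (glue a b g h) = h := by
  ext i
  by_cases hi : i < b
  · simp [rightPart, glue, hi, show ¬ (a + 1 + i < a) by omega, show a + 1 + i ≠ a by omega,
      show a + 1 + i < a + b + 1 by omega]
  · simp [rightPart, hi, hh.2.1 i (by omega)]

lemma glue_parts {a b : ℕ} {f : ℕ → ℕ} (hf : AvFun (a + b + 1) f) (ha : f a = a + b) :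
    glue a b (leftPart a b f) (rightPart a b f) = f := by
  ext i
  unfold glue
  split_ifs with p q r
  · have := hf.lower ha i p
    simp [leftPart, p]; omega
  · rw [q, ha]
  · have e : a + 1 + (i - (a + 1)) = i := by omega
    simp only [rightPart, show i - (a + 1) < b by omega, if_true, e]
  · exact (hf.2.1 i (by omega)).symm

/-- The decomposition at the maximum. -/
def splitEquiv (a b : ℕ) : {f // AvFun (a + b + 1) f ∧ f a = a + b} ≃
    {g // AvFun a g} × {h // AvFun b h} where
  toFun f := (⟨leftPart a b f.1, left_av f.2.1 f.2.2⟩, ⟨rightPart a b f.1, right_av f.2.1 f.2.2⟩)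
  invFun p := ⟨glue a b p.1.1 p.2.1, glue_av p.1.2 p.2.2, by simp [glue]⟩
  left_inv f := Subtype.ext (glue_parts f.2.1 f.2.2)
  right_inv p := Prod.ext (Subtype.ext (glue_left p.1.2)) (Subtype.ext (glue_right p.2.2))

/-- Classifying by position of the maximum. -/
noncomputable def maxEquiv (n : ℕ) : (Σ a : Fin (n + 1), {f // AvFun (n + 1) f ∧ f a = n}) ≃
    {f // AvFun (n + 1) f} := by
  refine Equiv.ofBijective (fun x => ⟨x.2.1, x.2.2.1⟩) ⟨?_, ?_⟩
  · rintro ⟨a, f, hf, ha⟩ ⟨a', f', hf', ha'⟩ h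
    simp only [Subtype.mk.injEq] at h
    subst h
    have : a = a' := Fin.ext (hf.2.2.1 a a' a.2 a'.2 (by omega))
    subst this
    rfl
  · rintro ⟨f, hf⟩
    obtain ⟨a, ha, h⟩ := hf.exists_max
    exact ⟨⟨⟨a, ha⟩, f, hf, h⟩, rfl⟩

lemma card_split (n a : ℕ) (ha : a ≤ n) : Nat.card {f // AvFun (n + 1) f ∧ f a = n} =
    Nat.card {f // AvFun a f} * Nat.card {f // AvFun (n - a) f} := by
  obtain ⟨b, rfl⟩ := Nat.exists_eq_add_of_le ha
  rw [Nat.card_congr (splitEquiv a b), Nat.card_prod, Nat.add_sub_cancel_left]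

lemma card_avFun (n : ℕ) : Nat.card {f // AvFun n f} = catalan n := by
  induction n using Nat.strong_induction_on with
  | _ n ih =>
    cases n with
    | zero =>
      rw [catalan_zero, Nat.card_eq_one_iff_unique]
      refine ⟨⟨fun f g => Subtype.ext (funext fun i => ?_)⟩, ⟨⟨fun _ => 0, ?_⟩⟩⟩
      · rw [f.2.2.1 i (by omega), g.2.2.1 i (by omega)]
      · simp [AvFun]
    | succ n =>
      have hfin : ∀ a : Fin (n + 1), Finite {f // AvFun (n + 1) f ∧ f a = n} := by
        intro a
        have := AvFun.finite (n + 1)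
        exact Finite.of_injective
          (fun f => (⟨f.1, f.2.1⟩ : {f // AvFun (n + 1) f}))
          (fun f g h => Subtype.ext (by simpa using h))
      rw [← Nat.card_congr (maxEquiv n), Nat.card_sigma, catalan_succ]
      refine Finset.sum_congr rfl fun a _ => ?_
      have := a.2
      rw [card_split n a (by omega), ih a (by omega), ih (n - a) (by omega)]

lemma avoids_iff_s15 {n : ℕ} (σ : Equiv.Perm (Fin n)) : Avoids σ pattern132 ↔
    ∀ i j k : Fin n, i < j → j < k → σ i < σ k → σ k < σ j → False := by
  have p0 : pattern132 0 = 0 := by decide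
  have p1 : pattern132 1 = 2 := by decide
  have p2 : pattern132 2 = 1 := by decide
  constructor
  · intro h i j k hij hjk hik hkj
    apply h
    refine ⟨![i, j, k], ?_, ?_⟩
    · intro x y hxy
      fin_cases x <;> fin_cases y <;> simp_all
      exact hij.trans hjk
    · intro x y
      have := hik.trans hkj
      fin_cases x <;> fin_cases y <;> simp [p0, p1, p2, *, le_of_lt]
  · rintro h ⟨f, hf, hp⟩
    refine h (f 0) (f 1) (f 2) (hf (by decide)) (hf (by decide)) ?_ ?_
    · rw [hp, p0, p2]; decide
    · rw [hp, p1, p2]; decide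

/-- Permutation to function. -/
def toAv {n : ℕ} (σ : Equiv.Perm (Fin n)) (i : ℕ) : ℕ := if h : i < n then σ ⟨i, h⟩ else 0

lemma toAv_av {n : ℕ} (σ : Equiv.Perm (Fin n)) (h : Avoids σ pattern132) : AvFun n (toAv σ) := by
  rw [avoids_iff_s15] at h
  refine ⟨?_, ?_, ?_, ?_⟩
  · intro i hi
    simp [toAv, hi]
  · intro i hi
    simp [toAv]; omega
  · intro i j hi hj hij
    simp only [toAv, hi, hj, dif_pos] at hij
    have := σ.injective (Fin.ext hij)
    simpa using this
  · intro i j k hij hjk hk hik hkj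
    have hj : j < n := by omega
    have hi : i < n := by omega
    simp only [toAv, hi, hj, hk, dif_pos] at hik hkj
    exact h ⟨i, hi⟩ ⟨j, hj⟩ ⟨k, hk⟩ hij hjk hik hkj

lemma card_Q (n a : ℕ) (ha : a ≤ n) :
    Qcount (n + 1) (a + 1) (n + 1) = Nat.card {f // AvFun (n + 1) f ∧ f a = n} := by
  unfold Qcount
  refine Nat.card_congr (Equiv.ofBijective (fun σ => ⟨toAv σ.1, toAv_av σ.1 σ.2.1, ?_⟩) ⟨?_, ?_⟩)
  · obtain ⟨σ, h, i, hi, hi'⟩ := σ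
    obtain rfl : (i : ℕ) = a := by omega
    simp only [toAv, i.2, dif_pos, Fin.eta]
    omega
  · rintro ⟨σ, h⟩ ⟨τ, h'⟩ e
    simp only [Subtype.mk.injEq] at e ⊢
    ext i
    have := congrFun e i
    simpa only [toAv, i.2, dif_pos, Fin.eta] using this
  · rintro ⟨f, hf, hfa⟩
    have hinj : Function.Injective
        (fun i : Fin (n + 1) => (⟨f i, hf.1 i i.2⟩ : Fin (n + 1))) := by
      intro i j h
      exact Fin.ext (hf.2.2.1 i j i.2 j.2 (by simpa using h))
    refine ⟨⟨Equiv.ofBijective _ (Finite.injective_iff_bijective.1 hinj), ?_, ?_⟩, ?_⟩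
    · rw [avoids_iff_s15]
      intro i j k hij hjk hik hkj
      exact hf.2.2.2 i j k hij hjk k.2 hik hkj
    · exact ⟨⟨a, by omega⟩, rfl, by simp [hfa]⟩
    · apply Subtype.ext
      ext i
      by_cases hi : i < n + 1
      · simp [toAv, hi]
      · simp [toAv, hi, hf.2.1 i (by omega)]

lemma Q_eq (n j : ℕ) (hj1 : 1 ≤ j) (hjn : j ≤ n) :
    Qcount n j n = catalan (j - 1) * catalan (n - j) := by
  obtain ⟨a, rfl⟩ := Nat.exists_eq_add_of_le' hj1
  obtain ⟨m, rfl⟩ := Nat.exists_eq_add_of_le' (hj1.trans hjn)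
  rw [card_Q m a (by omega), card_split m a (by omega), card_avFun, card_avFun]
  simp

/-- `Q_n(j, n) = C_{j-1} C_{n-j}`, and consequently `Q_n(j,n) = Q_n(n+1-j, n)`. -/
theorem Qcount_last_column (n j : ℕ) (hn : 1 ≤ n) (hj1 : 1 ≤ j) (hjn : j ≤ n) :
    Qcount n j n = catalan (j - 1) * catalan (n - j) ∧
      Qcount n j n = Qcount n (n + 1 - j) n := by
  refine ⟨Q_eq n j hj1 hjn, ?_⟩
  rw [Q_eq n j hj1 hjn, Q_eq n (n + 1 - j) (by omega) (by omega), mul_comm,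
    show n + 1 - j - 1 = n - j by omega, show n - (n + 1 - j) = j - 1 by omega]
end

section
/- For every n ≥ 1: Σ_{σ ∈ S_n(321)} fp(σ) = C_n, and Σ_{τ ∈ S_n(132)} fp(τ) = C_n. Equivalently, the expected number of fixed points of a uniformly random 321-avoiding permutation of size n, and of a uniformly random 132-avoiding permutation of size n, both equal 1 for all n. -/
open Filter Finset Real

/-- The number of fixed points of a permutation. -/
def fpCount {n : ℕ} (σ : Equiv.Perm (Fin n)) : ℕ :=
  (Finset.univ.filter (fun i : Fin n => σ i = i)).card

attribute [local instance] Classical.propDecidable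

set_option linter.unusedSimpArgs false

namespace FixedPts

theorem avoids321_iff {n : ℕ} (σ : Equiv.Perm (Fin n)) :
    Avoids σ pattern321 ↔ ∀ i j k : Fin n, i < j → j < k → ¬ (σ k < σ j ∧ σ j < σ i) := by
  have e0 : pattern321 0 = 2 := by decide
  have e1 : pattern321 1 = 1 := by decide
  have e2 : pattern321 2 = 0 := by decide
  unfold Avoids ContainsPattern
  constructor
  · rintro h i j k hij hjk ⟨h1, h2⟩
    apply h
    refine ⟨![i, j, k], ?_, ?_⟩
    · intro x y hxy
      fin_cases x <;> fin_cases y <;> simp at hxy ⊢ <;> first | assumption | exact hij.trans hjk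
    · have h3 := h1.trans h2
      intro x y
      fin_cases x <;> fin_cases y <;>
        simp [e0, e1, e2, h1, h2, h3, h1.le, h2.le, h3.le]
  · rintro h ⟨f, hf, hp⟩
    refine h (f 0) (f 1) (f 2) (hf (by decide)) (hf (by decide)) ⟨?_, ?_⟩
    · rw [hp, e1, e2]; decide
    · rw [hp, e1, e0]; decide

theorem avoids132_iff {n : ℕ} (σ : Equiv.Perm (Fin n)) :
    Avoids σ pattern132 ↔ ∀ i j k : Fin n, i < j → j < k → ¬ (σ i < σ k ∧ σ k < σ j) := by
  have e0 : pattern132 0 = 0 := by decide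
  have e1 : pattern132 1 = 2 := by decide
  have e2 : pattern132 2 = 1 := by decide
  unfold Avoids ContainsPattern
  constructor
  · rintro h i j k hij hjk ⟨h1, h2⟩
    apply h
    refine ⟨![i, j, k], ?_, ?_⟩
    · intro x y hxy
      fin_cases x <;> fin_cases y <;> simp at hxy ⊢ <;> first | assumption | exact hij.trans hjk
    · have h3 := h1.trans h2
      intro x y
      fin_cases x <;> fin_cases y <;>
        simp [e0, e1, e2, h1, h2, h3, h1.le, h2.le, h3.le]
  · rintro h ⟨f, hf, hp⟩
    refine h (f 0) (f 1) (f 2) (hf (by decide)) (hf (by decide)) ⟨?_, ?_⟩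
    · rw [hp, e0, e2]; decide
    · rw [hp, e1, e2]; decide

/-- The 321-avoiding permutations. -/
noncomputable def S321 (n : ℕ) : Finset (Equiv.Perm (Fin n)) :=
  Finset.univ.filter (fun σ : Equiv.Perm (Fin n) => Avoids σ pattern321)

/-- The 132-avoiding permutations. -/
noncomputable def S132 (n : ℕ) : Finset (Equiv.Perm (Fin n)) :=
  Finset.univ.filter (fun σ : Equiv.Perm (Fin n) => Avoids σ pattern132)

theorem mem_S321 {n : ℕ} (σ : Equiv.Perm (Fin n)) :
    σ ∈ S321 n ↔ ∀ i j k : Fin n, i < j → j < k → ¬ (σ k < σ j ∧ σ j < σ i) := by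
  simp only [S321, Finset.mem_filter, Finset.mem_univ, true_and, avoids321_iff]

theorem mem_S132 {n : ℕ} (σ : Equiv.Perm (Fin n)) :
    σ ∈ S132 n ↔ ∀ i j k : Fin n, i < j → j < k → ¬ (σ i < σ k ∧ σ k < σ j) := by
  simp only [S132, Finset.mem_filter, Finset.mem_univ, true_and, avoids132_iff]

/-- Index type of three consecutive blocks of sizes `a`, `1`, `b`. -/
abbrev Blk (a b : ℕ) := Fin a ⊕ (Unit ⊕ Fin b)

/-- Blocks placed in increasing order. -/
def posFun (a b : ℕ) : Blk a b → Fin (a + b + 1)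
  | Sum.inl x => ⟨x, by omega⟩
  | Sum.inr (Sum.inl _) => ⟨a, by omega⟩
  | Sum.inr (Sum.inr y) => ⟨a + 1 + y, by omega⟩

/-- Values of the blocks for a 132-avoiding permutation. -/
def valFun (a b : ℕ) : Blk a b → Fin (a + b + 1)
  | Sum.inl x => ⟨b + x, by omega⟩
  | Sum.inr (Sum.inl _) => ⟨a + b, by omega⟩
  | Sum.inr (Sum.inr y) => ⟨y, by omega⟩

theorem posFun_bij (a b : ℕ) : Function.Bijective (posFun a b) := by
  rw [Fintype.bijective_iff_injective_and_card]
  constructor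
  · rintro (x | x | x) (y | y | y) h <;> simp [posFun, Fin.ext_iff] at h ⊢ <;> omega
  · simp; omega

theorem valFun_bij (a b : ℕ) : Function.Bijective (valFun a b) := by
  rw [Fintype.bijective_iff_injective_and_card]
  constructor
  · rintro (x | x | x) (y | y | y) h <;> simp [valFun, Fin.ext_iff] at h ⊢ <;> omega
  · simp; omega

/-- `posFun` as an equivalence. -/
noncomputable def pos (a b : ℕ) : Blk a b ≃ Fin (a + b + 1) := Equiv.ofBijective _ (posFun_bij a b)

/-- `valFun` as an equivalence. -/
noncomputable def val (a b : ℕ) : Blk a b ≃ Fin (a + b + 1) := Equiv.ofBijective _ (valFun_bij a b)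

@[simp] theorem pos_l {a b : ℕ} (x : Fin a) : ((pos a b (Sum.inl x) : Fin _) : ℕ) = x := rfl
@[simp] theorem pos_m {a b : ℕ} (x : Unit) : ((pos a b (Sum.inr (Sum.inl x)) : Fin _) : ℕ) = a := rfl
@[simp] theorem pos_r {a b : ℕ} (x : Fin b) :
    ((pos a b (Sum.inr (Sum.inr x)) : Fin _) : ℕ) = a + 1 + x := rfl
@[simp] theorem val_l {a b : ℕ} (x : Fin a) : ((val a b (Sum.inl x) : Fin _) : ℕ) = b + x := rfl
@[simp] theorem val_m {a b : ℕ} (x : Unit) :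
    ((val a b (Sum.inr (Sum.inl x)) : Fin _) : ℕ) = a + b := rfl
@[simp] theorem val_r {a b : ℕ} (x : Fin b) :
    ((val a b (Sum.inr (Sum.inr x)) : Fin _) : ℕ) = x := rfl

/-- Glue two permutations along block placements. -/
def comb {a b n : ℕ} (P V : Blk a b ≃ Fin n) (L : Equiv.Perm (Fin a)) (R : Equiv.Perm (Fin b)) :
    Equiv.Perm (Fin n) :=
  P.symm.trans ((Equiv.sumCongr L (Equiv.sumCongr (Equiv.refl Unit) R)).trans V)

section
variable {a b n : ℕ} (P V : Blk a b ≃ Fin n) (L : Equiv.Perm (Fin a)) (R : Equiv.Perm (Fin b))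

@[simp] theorem comb_l (x : Fin a) : comb P V L R (P (Sum.inl x)) = V (Sum.inl (L x)) := by
  simp [comb]
@[simp] theorem comb_m (x : Unit) :
    comb P V L R (P (Sum.inr (Sum.inl x))) = V (Sum.inr (Sum.inl x)) := by
  simp [comb]
@[simp] theorem comb_r (x : Fin b) :
    comb P V L R (P (Sum.inr (Sum.inr x))) = V (Sum.inr (Sum.inr (R x))) := by
  simp [comb]

theorem comb_surj (σ : Equiv.Perm (Fin n))
    (h1 : ∀ x, ∃ x', σ (P (Sum.inl x)) = V (Sum.inl x'))
    (h2 : σ (P (Sum.inr (Sum.inl ()))) = V (Sum.inr (Sum.inl ()))) :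
    ∃ L R, comb P V L R = σ := by
  choose f hf using h1
  have hfi : Function.Injective f := by
    intro x y hxy
    have : σ (P (Sum.inl x)) = σ (P (Sum.inl y)) := by rw [hf, hf, hxy]
    simpa using this
  have hfs := Finite.surjective_of_injective hfi
  have h3 : ∀ y, ∃ y', σ (P (Sum.inr (Sum.inr y))) = V (Sum.inr (Sum.inr y')) := by
    intro y
    obtain ⟨z, hz⟩ := V.surjective (σ (P (Sum.inr (Sum.inr y))))
    rcases z with z | z | z
    · obtain ⟨x, rfl⟩ := hfs z
      rw [← hf] at hz
      simp at hz
    · rw [← h2] at hz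
      simp at hz
    · exact ⟨z, hz.symm⟩
  choose g hg using h3
  have hgi : Function.Injective g := by
    intro x y hxy
    have : σ (P (Sum.inr (Sum.inr x))) = σ (P (Sum.inr (Sum.inr y))) := by rw [hg, hg, hxy]
    simpa using this
  refine ⟨Equiv.ofBijective f ⟨hfi, hfs⟩,
    Equiv.ofBijective g ⟨hgi, Finite.surjective_of_injective hgi⟩, ?_⟩
  ext i
  obtain ⟨z, rfl⟩ := P.surjective i
  rcases z with z | z | z
  · rw [comb_l, hf]; rfl
  · simp [h2]
  · rw [comb_r, hg]; rfl

theorem comb_sum {M : Type*} [AddCommMonoid M] (S : Finset (Equiv.Perm (Fin n)))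
    (SL : Finset (Equiv.Perm (Fin a))) (SR : Finset (Equiv.Perm (Fin b)))
    (hS : ∀ σ ∈ S, (∀ x, ∃ x', σ (P (Sum.inl x)) = V (Sum.inl x')) ∧
      σ (P (Sum.inr (Sum.inl ()))) = V (Sum.inr (Sum.inl ())))
    (hLR : ∀ L R, comb P V L R ∈ S ↔ L ∈ SL ∧ R ∈ SR) (g : Equiv.Perm (Fin n) → M) :
    ∑ σ ∈ S, g σ = ∑ L ∈ SL, ∑ R ∈ SR, g (comb P V L R) := by
  rw [← Finset.sum_product']
  symm
  refine Finset.sum_bij (fun p _ => comb P V p.1 p.2) ?_ ?_ ?_ ?_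
  · rintro ⟨L, R⟩ h
    exact (hLR L R).2 (Finset.mem_product.1 h)
  · rintro ⟨L, R⟩ _ ⟨L', R'⟩ _ h
    simp only at h
    ext x
    · have := DFunLike.congr_fun h (P (Sum.inl x))
      simp at this
      simp [this]
    · have := DFunLike.congr_fun h (P (Sum.inr (Sum.inr x)))
      simp at this
      simp [this]
  · intro σ hσ
    obtain ⟨h1, h2⟩ := hS σ hσ
    obtain ⟨L, R, h⟩ := comb_surj P V σ h1 h2
    refine ⟨(L, R), ?_, h⟩
    rw [Finset.mem_product]
    exact (hLR L R).1 (h ▸ hσ)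
  · intros; rfl

end

theorem comb321_mem {a b : ℕ} (L : Equiv.Perm (Fin a)) (R : Equiv.Perm (Fin b)) :
    comb (pos a b) (pos a b) L R ∈ S321 (a + b + 1) ↔ L ∈ S321 a ∧ R ∈ S321 b := by
  simp only [mem_S321]
  constructor
  · intro h
    constructor
    · intro i j k hij hjk
      have := h (pos a b (Sum.inl i)) (pos a b (Sum.inl j)) (pos a b (Sum.inl k))
      simp only [comb_l, comb_r, Fin.lt_def, pos_l, pos_r, val_l, val_r] at this hij hjk ⊢
      omega
    · intro i j k hij hjk
      have := h (pos a b (Sum.inr (Sum.inr i))) (pos a b (Sum.inr (Sum.inr j)))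
        (pos a b (Sum.inr (Sum.inr k)))
      simp only [comb_l, comb_r, Fin.lt_def, pos_l, pos_r, val_l, val_r] at this hij hjk ⊢
      omega
  · rintro ⟨hL, hR⟩ i j k
    obtain ⟨i, rfl⟩ := (pos a b).surjective i
    obtain ⟨j, rfl⟩ := (pos a b).surjective j
    obtain ⟨k, rfl⟩ := (pos a b).surjective k
    rcases i with i | i | i <;> rcases j with j | j | j <;> rcases k with k | k | k <;>
      simp only [comb_l, comb_m, comb_r, Fin.lt_def, pos_l, pos_m, pos_r] <;>
      first
      | exact hL i j k
      | (have := hR i j k; simp only [Fin.lt_def] at this; omega)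
      | omega

theorem comb132_mem {a b : ℕ} (L : Equiv.Perm (Fin a)) (R : Equiv.Perm (Fin b)) :
    comb (pos a b) (val a b) L R ∈ S132 (a + b + 1) ↔ L ∈ S132 a ∧ R ∈ S132 b := by
  simp only [mem_S132]
  constructor
  · intro h
    constructor
    · intro i j k hij hjk
      have := h (pos a b (Sum.inl i)) (pos a b (Sum.inl j)) (pos a b (Sum.inl k))
      simp only [comb_l, comb_r, Fin.lt_def, pos_l, pos_r, val_l, val_r] at this hij hjk ⊢
      omega
    · intro i j k hij hjk
      have := h (pos a b (Sum.inr (Sum.inr i))) (pos a b (Sum.inr (Sum.inr j)))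
        (pos a b (Sum.inr (Sum.inr k)))
      simp only [comb_l, comb_r, Fin.lt_def, pos_l, pos_r, val_l, val_r] at this hij hjk ⊢
      omega
  · rintro ⟨hL, hR⟩ i j k
    obtain ⟨i, rfl⟩ := (pos a b).surjective i
    obtain ⟨j, rfl⟩ := (pos a b).surjective j
    obtain ⟨k, rfl⟩ := (pos a b).surjective k
    rcases i with i | i | i <;> rcases j with j | j | j <;> rcases k with k | k | k <;>
      simp only [comb_l, comb_m, comb_r, Fin.lt_def, pos_l, pos_m, pos_r, val_l, val_m, val_r] <;>
      first
      | (have := hL i j k; simp only [Fin.lt_def] at this; omega)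
      | (have := hR i j k; simp only [Fin.lt_def] at this; omega)
      | omega

theorem split321 {a b : ℕ} (σ : Equiv.Perm (Fin (a + b + 1))) (hσ : σ ∈ S321 (a + b + 1))
    (ha : σ ⟨a, by omega⟩ = ⟨a, by omega⟩) (x : Fin a) :
    ∃ x', σ (pos a b (Sum.inl x)) = pos a b (Sum.inl x') := by
  rw [mem_S321] at hσ
  set c : Fin (a + b + 1) := ⟨a, by omega⟩ with hc
  by_cases h : σ (pos a b (Sum.inl x)) < c
  · exact ⟨⟨σ (pos a b (Sum.inl x)), h⟩, Fin.ext rfl⟩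
  exfalso
  have hxc : pos a b (Sum.inl x) < c := by simp [Fin.lt_def, hc]
  have hne : σ (pos a b (Sum.inl x)) ≠ c := by
    rw [← ha]; intro h'; exact hxc.ne (σ.injective h')
  have hgt : c < σ (pos a b (Sum.inl x)) := lt_of_le_of_ne (not_lt.1 h) hne.symm
  have key : ∀ j ∈ Finset.Ici c, σ j ∈ Finset.Ici c := by
    intro j hj
    rw [Finset.mem_Ici] at hj ⊢
    by_contra hlt
    rw [not_le] at hlt
    rcases hj.eq_or_lt with rfl | hj
    · rw [ha] at hlt; exact lt_irrefl _ hlt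
    · exact hσ _ _ _ hxc hj ⟨by rwa [ha], by rwa [ha]⟩
  have hs := Finset.surj_on_of_inj_on_of_card_le (s := Finset.Ici c) (t := Finset.Ici c)
    (fun j _ => σ j) key (fun _ _ _ _ h => σ.injective h) le_rfl
  obtain ⟨j, hj, hjj⟩ := hs _ (Finset.mem_Ici.2 hgt.le)
  have := σ.injective hjj
  rw [Finset.mem_Ici, ← this] at hj
  exact absurd hxc (not_lt.2 hj)

theorem split132 {a b : ℕ} (σ : Equiv.Perm (Fin (a + b + 1))) (hσ : σ ∈ S132 (a + b + 1))
    (ha : σ ⟨a, by omega⟩ = Fin.last _) (x : Fin a) :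
    ∃ x', σ (pos a b (Sum.inl x)) = val a b (Sum.inl x') := by
  rw [mem_S132] at hσ
  set c : Fin (a + b + 1) := ⟨a, by omega⟩ with hc
  have hxc : pos a b (Sum.inl x) < c := by simp [Fin.lt_def, hc]
  have hlast : ∀ j, j ≠ c → σ j < Fin.last _ := by
    intro j hj
    refine lt_of_le_of_ne (Fin.le_last _) ?_
    rw [← ha]; exact fun h => hj (σ.injective h)
  have key : ∀ j ∈ Finset.Ioi c, σ j ∈ Finset.Iio (σ (pos a b (Sum.inl x))) := by
    intro j hj
    rw [Finset.mem_Ioi] at hj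
    rw [Finset.mem_Iio]
    by_contra hlt
    rw [not_lt] at hlt
    refine hσ _ _ _ hxc hj ⟨lt_of_le_of_ne hlt ?_, ?_⟩
    · intro h
      have := σ.injective h
      rw [← this] at hj
      exact absurd hxc (not_lt.2 hj.le)
    · rw [ha]; exact hlast j hj.ne'
  have hcard := Finset.card_le_card_of_injOn (s := Finset.Ioi c) σ key (σ.injective.injOn)
  rw [Fin.card_Ioi, Fin.card_Iio] at hcard
  have h2 := hlast _ hxc.ne
  rw [Fin.lt_def, Fin.val_last] at h2
  simp only [hc] at hcard
  refine ⟨⟨(σ (pos a b (Sum.inl x)) : ℕ) - b, by omega⟩, Fin.ext ?_⟩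
  simp
  omega

theorem card_fix321 (a b : ℕ) :
    ((S321 (a + b + 1)).filter (fun σ => σ ⟨a, by omega⟩ = ⟨a, by omega⟩)).card
      = (S321 a).card * (S321 b).card := by
  have := comb_sum (pos a b) (pos a b)
    ((S321 (a + b + 1)).filter (fun σ => σ ⟨a, by omega⟩ = ⟨a, by omega⟩)) (S321 a) (S321 b)
    (fun σ hσ => ⟨split321 σ (Finset.mem_filter.1 hσ).1 (Finset.mem_filter.1 hσ).2,
      (Finset.mem_filter.1 hσ).2⟩)
    (fun L R => by
      rw [Finset.mem_filter, comb321_mem]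
      exact and_iff_left (comb_m (pos a b) (pos a b) L R ())) (fun _ => (1 : ℕ))
  simpa using this

theorem sum_132 {M : Type*} [AddCommMonoid M] (a b : ℕ) (g : Equiv.Perm (Fin (a + b + 1)) → M) :
    ∑ σ ∈ (S132 (a + b + 1)).filter (fun σ => σ ⟨a, by omega⟩ = Fin.last _), g σ
      = ∑ L ∈ S132 a, ∑ R ∈ S132 b, g (comb (pos a b) (val a b) L R) := by
  refine comb_sum (pos a b) (val a b)
    ((S132 (a + b + 1)).filter (fun σ => σ ⟨a, by omega⟩ = Fin.last _)) (S132 a) (S132 b)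
    (fun σ hσ => ⟨split132 σ (Finset.mem_filter.1 hσ).1 (Finset.mem_filter.1 hσ).2,
      (Finset.mem_filter.1 hσ).2⟩)
    (fun L R => by
      rw [Finset.mem_filter, comb132_mem]
      exact and_iff_left (comb_m (pos a b) (val a b) L R ())) g

/-- Insert the value `p` in front. -/
def ins {n : ℕ} (p : Fin (n + 1)) (τ : Equiv.Perm (Fin n)) : Equiv.Perm (Fin (n + 1)) :=
  (finSuccEquiv' 0).trans ((Equiv.optionCongr τ).trans (finSuccEquiv' p).symm)

@[simp] theorem ins_zero {n : ℕ} (p : Fin (n + 1)) (τ : Equiv.Perm (Fin n)) : ins p τ 0 = p := by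
  simp [ins]

@[simp] theorem ins_succ {n : ℕ} (p : Fin (n + 1)) (τ : Equiv.Perm (Fin n)) (i : Fin n) :
    ins p τ i.succ = p.succAbove (τ i) := by
  have : (finSuccEquiv' (0 : Fin (n + 1))) i.succ = some i := by
    rw [← Fin.zero_succAbove, finSuccEquiv'_succAbove]
  simp [ins, this]

theorem ins_bij (n : ℕ) : Function.Bijective
    (fun p : Fin (n + 1) × Equiv.Perm (Fin n) => ins p.1 p.2) := by
  rw [Fintype.bijective_iff_injective_and_card]
  constructor
  · rintro ⟨p, τ⟩ ⟨p', τ'⟩ h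
    simp only at h
    have h0 := DFunLike.congr_fun h 0
    simp only [ins_zero] at h0
    subst h0
    congr 1
    ext1 i
    have := DFunLike.congr_fun h i.succ
    simpa using this
  · simp [Fintype.card_perm, Nat.factorial_succ]

/-- The values below `k` appear in increasing order. -/
def Ord {n : ℕ} (k : ℕ) (σ : Equiv.Perm (Fin n)) : Prop :=
  ∀ i j : Fin n, i < j → σ j < σ i → k ≤ (σ i : ℕ)

/-- The number of 321-avoiding permutations with values below `k` in order. -/
noncomputable def cnt (n k : ℕ) : ℕ := ((S321 n).filter (fun σ => Ord k σ)).card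

theorem sa_val {n : ℕ} (p : Fin (n + 1)) (x : Fin n) :
    ((x : ℕ) < p ∧ ((p.succAbove x : Fin (n + 1)) : ℕ) = x) ∨
    ((p : ℕ) ≤ x ∧ ((p.succAbove x : Fin (n + 1)) : ℕ) = x + 1) := by
  rcases lt_or_ge (x : ℕ) (p : ℕ) with h | h
  · left; exact ⟨h, by rw [Fin.succAbove_of_castSucc_lt _ _ (by simpa [Fin.lt_def] using h)]; rfl⟩
  · right; exact ⟨h, by rw [Fin.succAbove_of_le_castSucc _ _ (by simpa [Fin.le_def] using h)]; rfl⟩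

theorem ins_mem {n : ℕ} (p : Fin (n + 1)) (τ : Equiv.Perm (Fin n)) :
    ins p τ ∈ S321 (n + 1) ↔ τ ∈ S321 n ∧ Ord p τ := by
  simp only [mem_S321]
  constructor
  · intro h
    constructor
    · intro i j k hij hjk
      have := h i.succ j.succ k.succ (by simpa using hij) (by simpa using hjk)
      simpa using this
    · intro i j hij hlt
      have := h 0 i.succ j.succ (Fin.succ_pos _) (by simpa using hij)
      simp only [ins_zero, ins_succ] at this
      have h1 : p.succAbove (τ j) < p.succAbove (τ i) := by simpa using hlt
      have h2 : ¬ p.succAbove (τ i) < p := fun h => this ⟨h1, h⟩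
      rw [Fin.lt_def] at h2
      rcases sa_val p (τ i) with h | h <;> omega
  · rintro ⟨h1, h2⟩ i j k hij hjk
    refine Fin.cases ?_ (fun i => ?_) i hij
    · intro hij
      obtain ⟨j, rfl⟩ := Fin.exists_succ_eq.2 hij.ne'
      obtain ⟨k, rfl⟩ := Fin.exists_succ_eq.2 (hij.trans hjk).ne'
      simp only [ins_zero, ins_succ]
      rintro ⟨h3, h4⟩
      have := h2 j k (by simpa using hjk) (by simpa using h3)
      rw [Fin.lt_def] at h4
      rcases sa_val p (τ j) with h | h <;> omega
    · intro hij
      obtain ⟨j, rfl⟩ := Fin.exists_succ_eq.2 ((Fin.zero_le _).trans_lt hij).ne'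
      obtain ⟨k, rfl⟩ := Fin.exists_succ_eq.2 ((Fin.zero_le _).trans_lt hjk).ne'
      have := h1 i j k (by simpa using hij) (by simpa using hjk)
      simpa using this

theorem ins_ord {n : ℕ} (k : ℕ) (p : Fin (n + 1)) (τ : Equiv.Perm (Fin n)) :
    (Ord p τ ∧ Ord (k + 1) (ins p τ)) ↔
      (if (p : ℕ) = 0 then Ord k τ else (k + 1 ≤ (p : ℕ) ∧ Ord p τ)) := by
  split_ifs with hp
  · constructor
    · rintro ⟨-, h⟩ i j hij hlt
      have := h i.succ j.succ (by simpa using hij) (by simpa using hlt)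
      rw [ins_succ] at this
      rcases sa_val p (τ i) with h | h <;> omega
    · intro h
      refine ⟨fun i j _ _ => by omega, fun i j hij => ?_⟩
      obtain ⟨j, rfl⟩ := Fin.exists_succ_eq.2 ((Fin.zero_le _).trans_lt hij).ne'
      refine Fin.cases ?_ (fun i => ?_) i hij
      · intro hij hlt
        rw [ins_zero, Fin.lt_def] at hlt
        omega
      · intro hij hlt
        have := h i j (by simpa using hij) (by simpa using hlt)
        rw [ins_succ]
        rcases sa_val p (τ i) with h | h <;> omega
  · constructor
    · rintro ⟨h1, h⟩
      refine ⟨?_, h1⟩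
      obtain ⟨z, hz⟩ := (ins p τ).surjective 0
      have hz0 : z ≠ 0 := by
        rintro rfl
        rw [ins_zero] at hz
        exact hp (by simp [hz])
      have := h 0 z (Fin.pos_iff_ne_zero.2 hz0) (by
        rw [hz, ins_zero, Fin.lt_def]; simpa using Nat.pos_of_ne_zero hp)
      simpa using this
    · rintro ⟨h1, h⟩
      refine ⟨h, fun i j hij => ?_⟩
      obtain ⟨j, rfl⟩ := Fin.exists_succ_eq.2 ((Fin.zero_le _).trans_lt hij).ne'
      refine Fin.cases ?_ (fun i => ?_) i hij
      · intro hij hlt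
        rw [ins_zero]; exact h1
      · intro hij hlt
        have := h i j (by simpa using hij) (by simpa using hlt)
        rw [ins_succ]
        rcases sa_val p (τ i) with h | h <;> omega

theorem cnt_succ (n k : ℕ) (hk : k ≤ n) : cnt (n + 1) (k + 1) = ∑ p ∈ Finset.Icc k n, cnt n p := by
  have h1 : cnt (n + 1) (k + 1) = ∑ p : Fin (n + 1),
      (if (p : ℕ) = 0 then cnt n k else if k + 1 ≤ (p : ℕ) then cnt n p else 0) := by
    have e : cnt (n + 1) (k + 1) = ∑ σ : Equiv.Perm (Fin (n + 1)),
        if σ ∈ S321 (n + 1) ∧ Ord (k + 1) σ then 1 else 0 := by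
      rw [cnt, Finset.card_filter, ← Finset.sum_filter, Finset.sum_ite]
      simp [Finset.filter_and]
      congr 1
      ext; simp
    rw [e, ← (ins_bij n).sum_comp, Fintype.sum_prod_type]
    refine Finset.sum_congr rfl fun p _ => ?_
    have e2 : ∀ k', cnt n k' = ∑ τ : Equiv.Perm (Fin n), if τ ∈ S321 n ∧ Ord k' τ then 1 else 0 := by
      intro k'
      rw [← Finset.card_filter, cnt]
      congr 1
      ext; simp
    simp only [ins_mem, and_assoc, ins_ord]
    split_ifs with h0 h1
    · rw [e2]
    · rw [e2]; simp [h1]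
    · simp [h1]
  rw [h1, Fin.sum_univ_eq_sum_range
    (fun p => if p = 0 then cnt n k else if k + 1 ≤ p then cnt n p else 0) (n + 1),
    Finset.sum_range_succ', ← Finset.add_sum_Ioc_eq_sum_Icc hk, add_comm]
  simp only [if_true, Nat.add_eq_zero_iff, one_ne_zero, and_false, if_false]
  congr 1
  rw [← Finset.sum_filter]
  refine Finset.sum_bij (fun p _ => p + 1) ?_ ?_ ?_ ?_
  · intro p hp; simp at hp ⊢; omega
  · intro p _ q _ h; omega
  · intro p hp
    simp at hp
    exact ⟨p - 1, by simp; omega, by omega⟩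
  · intros; rfl

theorem cnt_zero_one (n : ℕ) : cnt n 0 = cnt n 1 := by
  unfold cnt
  congr 1
  apply Finset.filter_congr
  intro σ _
  constructor
  · intro _ i j _ h
    rw [Fin.lt_def] at h; omega
  · intro _ i j _ _; omega

theorem cnt_formula (n : ℕ) : ∀ j k, j + k = n →
    cnt n k + (n + j).choose (n + 1) = (n + j).choose n := by
  induction n with
  | zero =>
    intro j k h
    obtain ⟨rfl, rfl⟩ : j = 0 ∧ k = 0 := by omega
    have : (S321 0).filter (fun σ => Ord 0 σ) = Finset.univ := by
      ext σ
      simp only [Finset.mem_filter, mem_S321, Finset.mem_univ, iff_true]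
      exact ⟨fun i => i.elim0, fun i => i.elim0⟩
    simp [cnt, this]
  | succ n ih =>
    have key : ∀ j k, j + k = n →
        cnt (n + 1) (k + 1) + (n + 1 + j).choose (n + 1 + 1) = (n + 1 + j).choose (n + 1) := by
      intro j
      induction j with
      | zero =>
        intro k h
        obtain rfl : k = n := by omega
        have := ih 0 k (by omega)
        rw [cnt_succ _ _ le_rfl]
        simp at this ⊢
        exact this
      | succ j ihj =>
        intro k h
        have a1 := ih (j + 1) k h
        have a2 := ihj (k + 1) (by omega)
        rw [cnt_succ n (k + 1) (by omega)] at a2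
        rw [cnt_succ n k (by omega), ← Finset.add_sum_Ioc_eq_sum_Icc (by omega)]
        have e : Finset.Ioc k n = Finset.Icc (k + 1) n := by ext; simp
        rw [e, ← add_assoc (n + 1) j 1, Nat.choose_succ_succ' (n + 1 + j) (n + 1),
          Nat.choose_succ_succ' (n + 1 + j) n]
        rw [show n + (j + 1) = n + 1 + j by omega] at a1
        omega
    intro j k h
    rcases k with _ | k
    · obtain rfl : j = n + 1 := by omega
      have a := key n 0 (by omega)
      rw [cnt_zero_one, ← add_assoc (n + 1) n 1, Nat.choose_succ_succ' (n + 1 + n) (n + 1),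
        Nat.choose_succ_succ' (n + 1 + n) n]
      have : (n + 1 + n).choose n = (n + 1 + n).choose (n + 1) := by
        rw [← Nat.choose_symm_add, Nat.add_comm n 1]
      simp only [zero_add] at a ⊢
      omega
    · exact key j k (by omega)

theorem card_S321 (n : ℕ) : (S321 n).card = catalan n := by
  have h1 : (S321 n).card = cnt n 0 := by
    unfold cnt
    congr 1
    symm
    apply Finset.filter_true_of_mem
    intro σ _ i j _ _
    omega
  have h2 := cnt_formula n n 0 (by omega)
  have h3 := succ_mul_catalan_eq_centralBinom n
  have h4 := Nat.choose_succ_right_eq (n + n) n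
  rw [Nat.centralBinom, two_mul] at h3
  rw [Nat.add_sub_cancel] at h4
  rw [← h1] at h2
  have h5 : (n + 1) * (S321 n).card = (n + 1) * catalan n := by
    rw [h3]
    have : ((n + 1) * (S321 n).card + (n + n).choose (n + 1) * (n + 1))
      = (n + 1) * (n + n).choose n := by rw [← h2]; ring
    rw [h4] at this
    linarith
  exact Nat.eq_of_mul_eq_mul_left (Nat.succ_pos n) h5

theorem part321 (m : ℕ) : ∑ σ ∈ S321 (m + 1), fpCount σ = catalan (m + 1) := by
  have h : ∀ i : Fin (m + 1), ((S321 (m + 1)).filter (fun σ => σ i = i)).card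
      = catalan i * catalan (m - i) := by
    rintro ⟨a, ha⟩
    obtain ⟨b, rfl⟩ := Nat.exists_eq_add_of_le (Nat.lt_succ_iff.1 ha)
    have := card_fix321 a b
    rw [card_S321, card_S321] at this
    simpa using this
  rw [catalan_succ]
  simp only [fpCount, Finset.card_filter]
  rw [Finset.sum_comm]
  refine Finset.sum_congr rfl fun i _ => ?_
  rw [← h, Finset.card_filter]

open LaurentPolynomial in
/-- The generating Laurent polynomial of displacements. -/
noncomputable def Fl (n : ℕ) : LaurentPolynomial ℤ :=
  ∑ σ ∈ S132 n, ∑ i : Fin n, T (((σ i : ℕ) : ℤ) - ((i : ℕ) : ℤ))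

theorem sum_fiber {M : Type*} [AddCommMonoid M] (m : ℕ) (g : Equiv.Perm (Fin (m + 1)) → M) :
    ∑ σ ∈ S132 (m + 1), g σ
      = ∑ i : Fin (m + 1), ∑ σ ∈ (S132 (m + 1)).filter (fun σ => σ i = Fin.last _), g σ := by
  rw [← Finset.sum_fiberwise (S132 (m + 1)) (fun σ => σ.symm (Fin.last m)) g]
  refine Finset.sum_congr rfl fun i _ => ?_
  refine Finset.sum_congr ?_ fun _ _ => rfl
  apply Finset.filter_congr
  intro σ _
  rw [Equiv.symm_apply_eq, eq_comm]

theorem sum_fiber' {M : Type*} [AddCommMonoid M] (m : ℕ)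
    (g : (n : ℕ) → Equiv.Perm (Fin n) → M) (f : ℕ → ℕ → M)
    (h : ∀ a b, ∑ L ∈ S132 a, ∑ R ∈ S132 b, g _ (comb (pos a b) (val a b) L R) = f a b) :
    ∑ σ ∈ S132 (m + 1), g _ σ = ∑ p ∈ Finset.HasAntidiagonal.antidiagonal m, f p.1 p.2 := by
  rw [sum_fiber, Finset.Nat.sum_antidiagonal_eq_sum_range_succ f, Finset.sum_range]
  refine Finset.sum_congr rfl fun i _ => ?_
  rcases i with ⟨a, ha⟩
  obtain ⟨b, rfl⟩ := Nat.exists_eq_add_of_le (Nat.lt_succ_iff.1 ha)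
  have := sum_132 a b (g _)
  rw [h] at this
  simpa using this

theorem card_S132 (n : ℕ) : (S132 n).card = catalan n := by
  induction n using Nat.strong_induction_on with
  | _ n ih =>
    rcases n with _ | m
    · have : S132 0 = Finset.univ := by
        ext σ
        simp only [mem_S132, Finset.mem_univ, iff_true]
        exact fun i => i.elim0
      simp [this]
    · have := sum_fiber' m (fun _ _ => (1 : ℕ)) (fun a b => (S132 a).card * (S132 b).card)
        (fun a b => by simp)
      rw [catalan_succ', Finset.card_eq_sum_ones, this]
      refine Finset.sum_congr rfl fun p hp => ?_
      rw [Finset.HasAntidiagonal.mem_antidiagonal] at hp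
      rw [ih p.1 (by omega), ih p.2 (by omega)]

open LaurentPolynomial in
theorem Fl_succ (m : ℕ) : Fl (m + 1) = ∑ p ∈ Finset.HasAntidiagonal.antidiagonal m,
    (Fl p.1 * ((catalan p.2 : LaurentPolynomial ℤ) * T (p.2 : ℤ)) + (catalan p.1 : LaurentPolynomial ℤ) * ((catalan p.2 : LaurentPolynomial ℤ) * T (p.2 : ℤ))
      + T (-1) * (((catalan p.1 : LaurentPolynomial ℤ) * T (-(p.1 : ℤ))) * Fl p.2)) := by
  unfold Fl
  refine sum_fiber' m (fun n σ => ∑ i : Fin n, T (((σ i : ℕ) : ℤ) - ((i : ℕ) : ℤ)))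
    (fun a b => (∑ σ ∈ S132 a, ∑ i : Fin a, T (((σ i : ℕ) : ℤ) - ((i : ℕ) : ℤ)))
       * ((catalan b : LaurentPolynomial ℤ) * T (b : ℤ)) + (catalan a : LaurentPolynomial ℤ) * ((catalan b : LaurentPolynomial ℤ) * T (b : ℤ))
      + T (-1) * (((catalan a : LaurentPolynomial ℤ) * T (-(a : ℤ))) *
        (∑ σ ∈ S132 b, ∑ i : Fin b, T (((σ i : ℕ) : ℤ) - ((i : ℕ) : ℤ))))) ?_
  intro a b
  have h : ∀ L R, ∑ i, T (R := ℤ) (((comb (pos a b) (val a b) L R i : ℕ) : ℤ) - ((i : ℕ) : ℤ))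
      = T (b : ℤ) * (∑ i : Fin a, T (((L i : ℕ) : ℤ) - ((i : ℕ) : ℤ))) + T (b : ℤ)
        + T (-1) * T (-(a : ℤ)) * (∑ i : Fin b, T (((R i : ℕ) : ℤ) - ((i : ℕ) : ℤ))) := by
    intro L R
    rw [← (pos a b).sum_comp, Fintype.sum_sum_type, Fintype.sum_sum_type, Finset.mul_sum,
      Finset.mul_sum]
    simp only [comb_l, comb_m, comb_r, pos_l, pos_m, pos_r, val_l, val_m, val_r,
      Finset.univ_unique, Finset.sum_singleton, ← T_add]
    rw [← add_assoc]
    congr 1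
    · congr 1
      · refine Finset.sum_congr rfl fun i _ => ?_
        congr 1; push_cast; ring
      · congr 1; push_cast; ring
    · refine Finset.sum_congr rfl fun i _ => ?_
      congr 1; push_cast; ring
  simp only [h, Finset.sum_add_distrib, ← Finset.mul_sum, Finset.sum_const, nsmul_eq_mul,
    card_S132]
  ring

open LaurentPolynomial PowerSeries in
theorem main_identity (m : ℕ) :
    (T 1 - 1) * Fl (m + 1) = ∑ p ∈ Finset.HasAntidiagonal.antidiagonal m,
      (catalan p.1 : LaurentPolynomial ℤ) * ((catalan p.2 : LaurentPolynomial ℤ) * (T ((p.2 : ℤ) + 1) - T (-(p.2 : ℤ)))) := by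
  let F : PowerSeries (LaurentPolynomial ℤ) := PowerSeries.mk Fl
  let K : PowerSeries (LaurentPolynomial ℤ) := PowerSeries.mk (fun n => (catalan n : LaurentPolynomial ℤ))
  let A : PowerSeries (LaurentPolynomial ℤ) := PowerSeries.mk (fun n => (catalan n : LaurentPolynomial ℤ) * T (n : ℤ))
  let B : PowerSeries (LaurentPolynomial ℤ) := PowerSeries.mk (fun n => (catalan n : LaurentPolynomial ℤ) * T (-(n : ℤ)))
  let q : PowerSeries (LaurentPolynomial ℤ) := PowerSeries.C (T 1)
  let q' : PowerSeries (LaurentPolynomial ℤ) := PowerSeries.C (T (-1))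
  have hq : q * q' = 1 := by
    simp only [q, q', ← map_mul, ← T_add]
    simp
  have hA : A = 1 + q * (PowerSeries.X * (A * A)) := by
    ext1 n
    rcases n with _ | n
    · simp [A, q]
    · simp only [A, q, map_add, PowerSeries.coeff_C_mul, PowerSeries.coeff_succ_X_mul]
      simp only [PowerSeries.coeff_mul, PowerSeries.coeff_mk, PowerSeries.coeff_one]
      rw [if_neg (Nat.succ_ne_zero n), zero_add, catalan_succ', Finset.mul_sum, Nat.cast_sum,
        Finset.sum_mul]
      refine Finset.sum_congr rfl fun p hp => ?_
      rw [Finset.HasAntidiagonal.mem_antidiagonal] at hp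
      rw [← hp]
      push_cast
      rw [T_add, T_add]
      ring
  have hB : B = 1 + q' * (PowerSeries.X * (B * B)) := by
    ext1 n
    rcases n with _ | n
    · simp [B, q']
    · simp only [B, q', map_add, PowerSeries.coeff_C_mul, PowerSeries.coeff_succ_X_mul]
      simp only [PowerSeries.coeff_mul, PowerSeries.coeff_mk, PowerSeries.coeff_one]
      rw [if_neg (Nat.succ_ne_zero n), zero_add, catalan_succ', Finset.mul_sum, Nat.cast_sum,
        Finset.sum_mul]
      refine Finset.sum_congr rfl fun p hp => ?_
      rw [Finset.HasAntidiagonal.mem_antidiagonal] at hp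
      rw [← hp]
      push_cast
      rw [neg_add, neg_add, T_add, T_add]
      ring
  have hF : F = PowerSeries.X * (F * A + K * A + q' * (B * F)) := by
    ext1 n
    rcases n with _ | n
    · simp [F, Fl]
    · simp only [F, A, B, K, q', map_add, PowerSeries.coeff_C_mul, PowerSeries.coeff_succ_X_mul]
      simp only [PowerSeries.coeff_mul, PowerSeries.coeff_mk]
      rw [Fl_succ, Finset.mul_sum, ← Finset.sum_add_distrib, ← Finset.sum_add_distrib]
  have hU : (1 - PowerSeries.X * A - PowerSeries.X * (q' * B)) ≠ 0 := by
    intro h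
    have := congrArg PowerSeries.constantCoeff h
    simp at this
  have hmain : (q - 1) * F = PowerSeries.X * (K * (q * A - B)) := by
    apply mul_left_cancel₀ hU
    generalize PowerSeries.X (R := LaurentPolynomial ℤ) = X at *
    clear_value F K A B q q'
    linear_combination (q - 1) * hF - X * K * hA + X * K * hB + X * K * X * A * B * hq
  have := congrArg (PowerSeries.coeff (m + 1)) hmain
  simp only [F, A, B, K, q, PowerSeries.coeff_succ_X_mul, PowerSeries.coeff_mul (n := m)] at this
  rw [← map_one PowerSeries.C, ← map_sub, PowerSeries.coeff_C_mul] at this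
  simp only [map_sub, PowerSeries.coeff_C_mul, PowerSeries.coeff_mk] at this
  rw [this]
  refine Finset.sum_congr rfl fun p _ => ?_
  rw [T_add]
  ring

open LaurentPolynomial in
theorem T_geom (j : ℕ) : (T ((j : ℤ) + 1) - T (-(j : ℤ)) : LaurentPolynomial ℤ)
    = (T 1 - 1) * ∑ t ∈ Finset.range (2 * j + 1), T ((t : ℤ) - j) := by
  have := Finset.sum_range_sub (fun t : ℕ => (T ((t : ℤ) - j) : LaurentPolynomial ℤ)) (2 * j + 1)
  rw [Finset.mul_sum]
  have e : (T ((j : ℤ) + 1) - T (-(j : ℤ)) : LaurentPolynomial ℤ)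
      = T (((2 * j + 1 : ℕ) : ℤ) - j) - T (((0 : ℕ) : ℤ) - j) := by
    congr 2 <;> push_cast <;> ring
  rw [e, ← this]
  refine Finset.sum_congr rfl fun t _ => ?_
  rw [sub_mul, ← T_add, one_mul]
  congr 2
  push_cast; ring

open LaurentPolynomial in
theorem Fl_formula (m : ℕ) : Fl (m + 1) = ∑ p ∈ Finset.HasAntidiagonal.antidiagonal m,
    (catalan p.1 * catalan p.2) • ∑ t ∈ Finset.range (2 * p.2 + 1), T ((t : ℤ) - p.2) := by
  have hT : (T 1 - 1 : LaurentPolynomial ℤ) ≠ 0 := by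
    intro h
    have := congrArg (fun f : LaurentPolynomial ℤ => f.coeff 1) (sub_eq_zero.1 h)
    rw [← T_zero] at this
    simp only [T_apply] at this
    norm_num at this
  apply mul_left_cancel₀ hT
  rw [main_identity, Finset.mul_sum]
  refine Finset.sum_congr rfl fun p _ => ?_
  rw [T_geom, nsmul_eq_mul]
  push_cast
  ring

/-- Constant term. -/
noncomputable def ct : LaurentPolynomial ℤ →+ ℤ :=
  (Finsupp.applyAddHom 0).comp AddMonoidAlgebra.coeffAddEquiv.toAddMonoidHom

theorem ct_T (k : ℤ) : ct (LaurentPolynomial.T k) = if k = 0 then 1 else 0 :=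
  LaurentPolynomial.T_apply 0 k

theorem part132 (m : ℕ) : ∑ σ ∈ S132 (m + 1), fpCount σ = catalan (m + 1) := by
  have h1 : ct (Fl (m + 1)) = ((∑ σ ∈ S132 (m + 1), fpCount σ : ℕ) : ℤ) := by
    simp only [Fl, map_sum, ct_T, fpCount, Finset.card_filter]
    push_cast
    refine Finset.sum_congr rfl fun σ _ => Finset.sum_congr rfl fun i _ => ?_
    congr 1
    rw [Fin.ext_iff, sub_eq_zero, Nat.cast_inj]
  have h2 : ct (Fl (m + 1)) = (catalan (m + 1) : ℤ) := by
    rw [Fl_formula, map_sum, catalan_succ', Nat.cast_sum]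
    refine Finset.sum_congr rfl fun p _ => ?_
    rw [map_nsmul, map_sum, Finset.sum_eq_single p.2]
    · rw [ct_T, if_pos (sub_self _)]; simp
    · intro t _ ht
      rw [ct_T, if_neg]
      omega
    · intro h
      exact absurd (Finset.mem_range.2 (by omega)) h
  rw [h1] at h2
  exact_mod_cast h2

end FixedPts

/-- For every `n ≥ 1`, `Σ_{σ ∈ S_n(321)} fp(σ) = C_n` and `Σ_{τ ∈ S_n(132)} fp(τ) = C_n`;
since `|S_n(321)| = |S_n(132)| = C_n`, the expected number of fixed points of a uniform
`321`-avoiding (resp. `132`-avoiding) permutation equals `1`. -/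
theorem sum_fixed_points_321_132 (n : ℕ) (hn : 1 ≤ n) :
    (∑ σ ∈ Finset.univ.filter (fun σ : Equiv.Perm (Fin n) => Avoids σ pattern321),
        fpCount σ) = catalan n ∧
    (∑ τ ∈ Finset.univ.filter (fun τ : Equiv.Perm (Fin n) => Avoids τ pattern132),
        fpCount τ) = catalan n := by
  obtain ⟨m, rfl⟩ : ∃ m, n = m + 1 := ⟨n - 1, by omega⟩
  exact ⟨FixedPts.part321 m, FixedPts.part132 m⟩
end
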